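/- arXiv:2206.10726 — 4 statements merged into one kernel-verified Lean document; each statement's English description precedes it below -/
import Mathlib

section
/- Let G be a group, κ ∈ G central with κ ≠ 1 and κ² = 1. Let g₁, g₂, g₃ ∈ G have conjugacy classes {g_i, κ·g_i} with g₁·g₂ = κ·g₂·g₁, g₂·g₃ = κ·g₃·g₂ and g₁·g₃ = g₃·g₁, let g₄ ∈ G be central, and suppose G is generated by g₁, g₂, g₃, g₄. Let χ_i : C_G(g_i) → kˣ (i = 1, 2, 3) and χ₄ : G → kˣ be group homomorphisms with χ_i(g_i) = −1 for all i, satisfying χ₁(κ·g₂²)·χ₂(κ·g₁²) = 1, χ₂(κ·g₃²)·χ₃(κ·g₂²) = 1, χ₁(g₃)·χ₃(g₁) = 1, χ₁(κ)·χ₃(κ) = 1, χ₁(g₄)·χ₄(g₁) = 1, χ₂(g₄)·χ₄(g₂) = 1 and χ₃(g₄)·χ₄(g₃) = −1 (the conditions defining a Yetter–Drinfeld module of type γ₄ whose support generates G). Then there exists a 2-cocycle σ on G with values in kˣ such that σ(g_i, κ)·σ(κ, g_i)⁻¹·χ_i(κ) = 1 for i = 1, 2, 3, 4. -/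
namespace GammaFour

/-- The central extension of `N` by `V` given by a function `c : N → N → V`. -/
@[ext]
structure CocycleExt {N V : Type*} (c : N → N → V) where
  fst : N
  snd : V

namespace CocycleExt

variable {N V : Type*} [Group N] [AddCommGroup V] {c : N → N → V}

instance : Mul (CocycleExt c) := ⟨fun x y ↦ ⟨x.fst * y.fst, x.snd + y.snd + c x.fst y.fst⟩⟩

instance : One (CocycleExt c) := ⟨⟨1, 0⟩⟩

instance : Inv (CocycleExt c) := ⟨fun x ↦ ⟨x.fst⁻¹, -x.snd - c x.fst⁻¹ x.fst⟩⟩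

@[simp] lemma mul_fst (x y : CocycleExt c) : (x * y).fst = x.fst * y.fst := rfl
@[simp] lemma mul_snd (x y : CocycleExt c) :
    (x * y).snd = x.snd + y.snd + c x.fst y.fst := rfl
@[simp] lemma one_fst : (1 : CocycleExt c).fst = 1 := rfl
@[simp] lemma one_snd : (1 : CocycleExt c).snd = 0 := rfl
@[simp] lemma inv_fst (x : CocycleExt c) : (x⁻¹).fst = x.fst⁻¹ := rfl
@[simp] lemma inv_snd (x : CocycleExt c) : (x⁻¹).snd = -x.snd - c x.fst⁻¹ x.fst := rfl

/-- The group structure on the extension by a normalized 2-cocycle. -/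
abbrev group (hc : ∀ x y z, c x y + c (x * y) z = c x (y * z) + c y z)
    (hc₁ : ∀ x, c 1 x = 0) : Group (CocycleExt c) :=
  Group.ofLeftAxioms
    (fun x y z ↦ by
      ext
      · simp [mul_assoc]
      · simp only [mul_snd, mul_fst]
        linear_combination (norm := module) hc x.fst y.fst z.fst)
    (fun x ↦ by ext <;> simp [hc₁])
    (fun x ↦ by
      ext
      · simp
      · simp only [mul_snd, inv_snd, inv_fst, one_snd]
        abel)

end CocycleExt

/-- A divisible subgroup of an abelian group is a direct summand. -/
lemma exists_retraction {V C : Type*} [AddCommGroup V] [DivisibleBy V ℤ] [Group C]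
    (hC : ∀ x y : C, x * y = y * x)
    (ι : V →+ Additive C) (hι : Function.Injective ι) :
    ∃ φ : Additive C →+ V, ∀ a, φ (ι a) = a := by
  let _ : CommGroup C := { ‹Group C› with mul_comm := hC }
  obtain ⟨φ, hφ⟩ := (Module.Baer.of_divisible V).extension_property_addMonoidHom ι hι
    (AddMonoidHom.id V)
  exact ⟨φ, DFunLike.congr_fun hφ⟩

/-- A central extension `p : E → G` together with a divisible central subgroup `V` of `E` yields
a 2-cocycle on `G` whose commutator pairing is computed in `E`. -/
theorem exists_cocycle_of_extension {E G V : Type*} [Group E] [Group G] [AddCommGroup V]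
    [DivisibleBy V ℤ] (p : E →* G) (hp : Function.Surjective p)
    (hker : ∀ x, p x = 1 → x ∈ Subgroup.center E)
    (ι : V →+ Additive (Subgroup.center E)) (hι : Function.Injective ι)
    (hpι : ∀ l, p ((ι l).toMul : E) = 1) :
    ∃ σ : G → G → V, (∀ x y z, σ x y + σ (x * y) z = σ x (y * z) + σ y z) ∧
      ∀ (X Y : E) (l : V), X * Y = ((ι l).toMul : E) * (Y * X) →
        σ (p X) (p Y) = l + σ (p Y) (p X) := by
  let Z := Subgroup.center E
  have hC : ∀ x y : Z, x * y = y * x := fun x y ↦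
    Subtype.ext (Subgroup.mem_center_iff.1 y.2 x)
  obtain ⟨φ, hφ⟩ := exists_retraction hC ι hι
  let s := Function.surjInv hp
  have hs : ∀ g, p (s g) = g := Function.surjInv_eq hp
  have hd : ∀ g h, s g * s h * (s (g * h))⁻¹ ∈ Z := fun g h ↦ hker _ (by simp [hs])
  let d : G → G → Z := fun g h ↦ ⟨s g * s h * (s (g * h))⁻¹, hd g h⟩
  have hds : ∀ g h, s g * s h = d g h * s (g * h) := fun g h ↦ by simp [d]
  have hcent : ∀ (z : Z) (x : E), x * z = z * x := fun z x ↦ Subgroup.mem_center_iff.1 z.2 x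
  refine ⟨fun g h ↦ φ (Additive.ofMul (d g h)), fun x y z ↦ ?_, fun X Y l hXY ↦ ?_⟩
  · have key : d x y * d (x * y) z = d x (y * z) * d y z := ?_
    · simpa only [ofMul_mul, map_add] using congrArg (fun z ↦ φ (Additive.ofMul z)) key
    apply Subtype.ext
    apply mul_right_cancel (b := s (x * y * z))
    simp only [Subgroup.coe_mul]
    calc (d x y : E) * d (x * y) z * s (x * y * z)
        = s x * s y * s z := by rw [mul_assoc, ← hds, ← mul_assoc, ← hds]
      _ = s x * (d y z * s (y * z)) := by rw [mul_assoc, hds y z]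
      _ = d y z * (s x * s (y * z)) := by rw [← mul_assoc, hcent, mul_assoc]
      _ = d x (y * z) * d y z * s (x * y * z) := by
        rw [hds, ← mul_assoc, ← hcent, mul_assoc x]
  · have lift_eq : ∀ X : E, ∃ a : Z, s (p X) = a * X := fun X ↦
      ⟨⟨s (p X) * X⁻¹, hker _ (by simp [hs])⟩, by simp⟩
    obtain ⟨a, ha⟩ := lift_eq X
    obtain ⟨b, hb⟩ := lift_eq Y
    have swap : ∀ (a b : Z) (X Y : E), (a : E) * X * (b * Y) = (a * b : Z) * (X * Y) :=
      fun a b X Y ↦ by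
        rw [mul_assoc, ← mul_assoc X, hcent b X, Subgroup.coe_mul]
        simp only [mul_assoc]
    have key : d (p X) (p Y) = (ι l).toMul * d (p Y) (p X) := by
      apply Subtype.ext
      apply mul_right_cancel (b := s (p X * p Y))
      have hcomm : p X * p Y = p Y * p X := by
        rw [← map_mul, hXY, map_mul, hpι, one_mul, map_mul]
      rw [← hds, Subgroup.coe_mul, hcomm, mul_assoc, ← hds, ha, hb, swap, swap, hXY,
        hC b a, ← mul_assoc, hcent, mul_assoc]
    beta_reduce
    rw [key, ofMul_mul, map_add, ofMul_toMul, hφ]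

/-- A 2-cocycle on `N` with values in a divisible group descends along a surjection whose kernel
lies in the radical of the cocycle, up to a coboundary. -/
theorem exists_cocycle_of_surjective {N G V : Type*} [Group N] [Group G] [AddCommGroup V]
    [DivisibleBy V ℤ] (π : N →* G) (hπ : Function.Surjective π) (c : N → N → V)
    (hc : ∀ x y z, c x y + c (x * y) z = c x (y * z) + c y z) (hc₁ : ∀ x, c 1 x = 0)
    (hK : ∀ w, π w = 1 → ∀ v, w * v = v * w ∧ c w v = c v w) :
    ∃ σ : G → G → V, (∀ x y z, σ x y + σ (x * y) z = σ x (y * z) + σ y z) ∧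
      ∀ x y : N, x * y = y * x → σ (π x) (π y) - σ (π y) (π x) = c x y - c y x := by
  let _ := CocycleExt.group hc hc₁
  let p : CocycleExt c →* G :=
    { toFun := fun x ↦ π x.fst
      map_one' := map_one π
      map_mul' := fun x y ↦ map_mul π _ _ }
  have hp : Function.Surjective p := fun g ↦ by
    obtain ⟨n, hn⟩ := hπ g
    exact ⟨⟨n, 0⟩, hn⟩
  have hker : ∀ x, p x = 1 → x ∈ Subgroup.center (CocycleExt c) := fun x hx ↦ by
    refine Subgroup.mem_center_iff.2 fun y ↦ ?_
    obtain ⟨h₁, h₂⟩ := hK _ hx y.fst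
    ext
    · exact h₁.symm
    · simp only [CocycleExt.mul_snd]
      rw [h₂, add_comm x.snd]
  let ι : V →+ Additive (Subgroup.center (CocycleExt c)) :=
    AddMonoidHom.mk' (fun a ↦ Additive.ofMul ⟨⟨1, a⟩, hker ⟨1, a⟩ (map_one π)⟩) fun a b ↦ by
      apply Additive.toMul.injective
      apply Subtype.ext
      ext
      · change (1 : N) = 1 * 1
        simp
      · change a + b = a + b + c 1 1
        simp [hc₁]
  have hι : Function.Injective ι := fun a b h ↦
    congrArg (fun z ↦ (z.toMul : CocycleExt c).snd) h
  obtain ⟨σ, hσ, hσ'⟩ := exists_cocycle_of_extension p hp hker ι hι fun _ ↦ map_one π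
  refine ⟨σ, hσ, fun x y hxy ↦ sub_eq_iff_eq_add.2 (hσ' ⟨x, 0⟩ ⟨y, 0⟩ _ ?_)⟩
  ext
  · change x * y = 1 * (y * x)
    rw [one_mul, hxy]
  · change 0 + 0 + c x y = c x y - c y x + (0 + 0 + c y x) + c 1 _
    simp [hc₁]

/-- The residue modulo two of the triangular number `n * (n - 1) / 2`. -/
def tri (n : ℤ) : ZMod 2 := ((n * (n - 1) / 2 : ℤ) : ZMod 2)

lemma tri_zero : tri 0 = 0 := rfl

lemma tri_add (m n : ℤ) : tri (m + n) = tri m + tri n + m * n := by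
  unfold tri
  obtain ⟨s, hs⟩ := (Int.even_mul_pred_self m).two_dvd
  obtain ⟨t, ht⟩ := (Int.even_mul_pred_self n).two_dvd
  have h : (m + n) * (m + n - 1) = 2 * (s + t + m * n) := by linear_combination hs + ht
  rw [h, hs, ht]
  simp

lemma tri_two_mul (n : ℤ) : tri (2 * n) = n := by
  have h : 2 * n * (2 * n - 1) = 2 * (n * (2 * n - 1)) := by ring
  have h2 : (2 : ZMod 2) = 0 := rfl
  unfold tri
  rw [h, Int.mul_ediv_cancel_left _ two_ne_zero]
  push_cast
  rw [h2, zero_mul, zero_sub, mul_neg_one, ZMod.neg_eq_self_mod_two]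

/-- The homomorphism from `ZMod 2` sending `1` to an element killed by two. -/
def modTwoHom {A : Type*} [AddGroup A] (a : A) (ha : 2 • a = 0) : ZMod 2 →+ A :=
  ZMod.lift 2 ⟨zmultiplesHom A a, by simpa [← natCast_zsmul] using ha⟩

lemma modTwoHom_intCast {A : Type*} [AddGroup A] (a : A) (ha : 2 • a = 0) (m : ℤ) :
    modTwoHom a ha m = m • a := by
  simp [modTwoHom]

lemma modTwoHom_one {A : Type*} [AddGroup A] (a : A) (ha : 2 • a = 0) :
    modTwoHom a ha 1 = a := by
  simpa using modTwoHom_intCast a ha 1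

lemma modTwoHom_injective {A : Type*} [AddGroup A] {a : A} (ha : 2 • a = 0) (h : a ≠ 0) :
    Function.Injective (modTwoHom a ha) := by
  refine (injective_iff_map_eq_zero _).2 fun x hx ↦ ?_
  fin_cases x
  · rfl
  · exact absurd ((modTwoHom_one a ha).symm.trans hx) h

lemma zpow_mul_zpow_of_commutator {G : Type*} [Group G] {κ g h : G} (hκ : ∀ x, κ * x = x * κ)
    (hgh : h * g = g * h * κ) (m n : ℤ) : h ^ n * g ^ m = g ^ m * h ^ n * κ ^ (n * m) := by
  have hκc : ∀ x, Commute κ x := hκ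
  have h₁ : SemiconjBy h g (g * κ) := by
    change h * g = g * κ * h
    rw [hgh, mul_assoc, mul_assoc, hκ]
  have h₂ := h₁.zpow_right m
  rw [(hκc g).symm.mul_zpow] at h₂
  have h₃ : SemiconjBy (g ^ m) (h * κ ^ m) h := by
    change g ^ m * (h * κ ^ m) = h * g ^ m
    rw [h₂.eq, mul_assoc, ((hκc h).zpow_left m).eq]
  have h₄ := (h₃.zpow_right n).eq
  rw [((hκc h).zpow_left m).symm.mul_zpow, ← zpow_mul, mul_comm m n] at h₄
  rw [← h₄, mul_assoc]

/-- The word `g₁ ^ a * g₃ ^ c * g₄ ^ d * g₂ ^ b * κ ^ e` in normal form. -/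
@[ext]
structure Word where
  a : ℤ
  b : ℤ
  c : ℤ
  d : ℤ
  e : ZMod 2

namespace Word

instance : Mul Word := ⟨fun x y ↦
  ⟨x.a + y.a, x.b + y.b, x.c + y.c, x.d + y.d, x.e + y.e + x.b * (y.a + y.c)⟩⟩

instance : One Word := ⟨⟨0, 0, 0, 0, 0⟩⟩

instance : Inv Word := ⟨fun x ↦ ⟨-x.a, -x.b, -x.c, -x.d, -x.e + x.b * (x.a + x.c)⟩⟩

@[simp] lemma mul_a (x y : Word) : (x * y).a = x.a + y.a := rfl
@[simp] lemma mul_b (x y : Word) : (x * y).b = x.b + y.b := rfl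
@[simp] lemma mul_c (x y : Word) : (x * y).c = x.c + y.c := rfl
@[simp] lemma mul_d (x y : Word) : (x * y).d = x.d + y.d := rfl
@[simp] lemma mul_e (x y : Word) : (x * y).e = x.e + y.e + x.b * (y.a + y.c) := rfl
@[simp] lemma one_a : (1 : Word).a = 0 := rfl
@[simp] lemma one_b : (1 : Word).b = 0 := rfl
@[simp] lemma one_c : (1 : Word).c = 0 := rfl
@[simp] lemma one_d : (1 : Word).d = 0 := rfl
@[simp] lemma one_e : (1 : Word).e = 0 := rfl
@[simp] lemma inv_a (x : Word) : (x⁻¹).a = -x.a := rfl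
@[simp] lemma inv_b (x : Word) : (x⁻¹).b = -x.b := rfl
@[simp] lemma inv_c (x : Word) : (x⁻¹).c = -x.c := rfl
@[simp] lemma inv_d (x : Word) : (x⁻¹).d = -x.d := rfl
@[simp] lemma inv_e (x : Word) : (x⁻¹).e = -x.e + x.b * (x.a + x.c) := rfl

instance : Group Word :=
  Group.ofLeftAxioms
    (fun x y z ↦ by
      ext <;> simp only [mul_a, mul_b, mul_c, mul_d, mul_e] <;> push_cast <;> ring)
    (fun x ↦ by ext <;> simp)
    (fun x ↦ by
      ext <;> simp only [mul_a, mul_b, mul_c, mul_d, mul_e, inv_a, inv_b, inv_c, inv_d, inv_e,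
        one_a, one_b, one_c, one_d, one_e] <;> push_cast <;> ring)

lemma mul_comm_iff (x y : Word) :
    x * y = y * x ↔ (x.b * (y.a + y.c) : ZMod 2) = y.b * (x.a + x.c) := by
  constructor
  · intro h
    have := congrArg Word.e h
    simp only [mul_e] at this
    linear_combination this
  · intro h
    ext
    · exact add_comm _ _
    · exact add_comm _ _
    · exact add_comm _ _
    · exact add_comm _ _
    · simp only [mul_e]
      linear_combination h

section Eval

variable {G : Type*} [Group G] {κ g₁ g₂ g₃ g₄ : G}

/-- Evaluation of words in a group. -/
def eval (hκ : ∀ x, κ * x = x * κ) (hκ2 : κ ^ 2 = 1)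
    (h₂₁ : g₂ * g₁ = g₁ * g₂ * κ) (h₂₃ : g₂ * g₃ = g₃ * g₂ * κ) (h₁₃ : g₁ * g₃ = g₃ * g₁)
    (h₄ : ∀ x, g₄ * x = x * g₄) : Word →* G where
  toFun x := g₁ ^ x.a * g₃ ^ x.c * g₄ ^ x.d * g₂ ^ x.b *
    (modTwoHom (Additive.ofMul κ) hκ2 x.e).toMul
  map_one' := by simp
  map_mul' x y := by
    obtain ⟨e, he⟩ := ZMod.intCast_surjective x.e
    obtain ⟨e', he'⟩ := ZMod.intCast_surjective y.e
    have hxy : (x * y).e = ((x.b * y.a + x.b * y.c + (e + e') : ℤ) : ZMod 2) := by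
      rw [mul_e, ← he, ← he']
      push_cast
      ring
    have hm : ∀ m : ℤ, (modTwoHom (Additive.ofMul κ) hκ2 m).toMul = κ ^ m := fun m ↦
      congrArg Additive.toMul (modTwoHom_intCast _ _ m)
    have hκc : ∀ (m : ℤ) (z : G), κ ^ m * z = z * κ ^ m := fun m z ↦
      ((show Commute κ z from hκ z).zpow_left m).eq
    have h₄c : ∀ z : G, g₄ ^ x.d * z = z * g₄ ^ x.d := fun z ↦
      ((show Commute g₄ z from h₄ z).zpow_left _).eq
    have h₁₃c : g₁ ^ y.a * g₃ ^ x.c = g₃ ^ x.c * g₁ ^ y.a :=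
      ((show Commute g₁ g₃ from h₁₃).zpow_zpow _ _).eq
    have e₁ := zpow_mul_zpow_of_commutator hκ h₂₁ y.a x.b
    have e₃ := zpow_mul_zpow_of_commutator hκ h₂₃ y.c x.b
    simp only [hxy, ← he, ← he', hm, mul_a, mul_b, mul_c, mul_d, zpow_add]
    symm
    calc g₁ ^ x.a * g₃ ^ x.c * g₄ ^ x.d * g₂ ^ x.b * κ ^ e *
          (g₁ ^ y.a * g₃ ^ y.c * g₄ ^ y.d * g₂ ^ y.b * κ ^ e')
        = g₁ ^ x.a * g₃ ^ x.c * (g₄ ^ x.d * (g₂ ^ x.b * (κ ^ e *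
            (g₁ ^ y.a * g₃ ^ y.c * g₄ ^ y.d * g₂ ^ y.b)))) * κ ^ e' := by
          simp only [mul_assoc]
      _ = g₁ ^ x.a * g₃ ^ x.c * (g₂ ^ x.b * g₁ ^ y.a) * g₃ ^ y.c *
            (g₄ ^ y.d * (g₂ ^ y.b * (κ ^ e * (g₄ ^ x.d * κ ^ e')))) := by
          rw [hκc e, h₄c]
          simp only [mul_assoc]
      _ = g₁ ^ x.a * g₃ ^ x.c * g₁ ^ y.a * g₂ ^ x.b * (κ ^ (x.b * y.a) *
            (g₃ ^ y.c * (g₄ ^ y.d * (g₂ ^ y.b * (κ ^ e * (g₄ ^ x.d * κ ^ e')))))) := by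
          rw [e₁]
          simp only [mul_assoc]
      _ = g₁ ^ x.a * (g₃ ^ x.c * g₁ ^ y.a) * (g₂ ^ x.b * g₃ ^ y.c) * g₄ ^ y.d * g₂ ^ y.b *
            ((κ ^ e * (g₄ ^ x.d * κ ^ e')) * κ ^ (x.b * y.a)) := by
          rw [hκc]
          simp only [mul_assoc]
      _ = g₁ ^ x.a * g₁ ^ y.a * (g₃ ^ x.c * g₃ ^ y.c) * (g₂ ^ x.b * (κ ^ (x.b * y.c) *
            (g₄ ^ y.d * g₂ ^ y.b * (κ ^ e * (g₄ ^ x.d * κ ^ e') * κ ^ (x.b * y.a))))) := by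
          rw [e₃, ← h₁₃c]
          simp only [mul_assoc]
      _ = g₁ ^ x.a * g₁ ^ y.a * (g₃ ^ x.c * g₃ ^ y.c) * (g₄ ^ x.d * (g₂ ^ x.b * g₄ ^ y.d) *
            g₂ ^ y.b) * ((κ ^ e * κ ^ e') * κ ^ (x.b * y.a) * κ ^ (x.b * y.c)) := by
          rw [hκc (x.b * y.c), ← mul_assoc (κ ^ e), hκc e (g₄ ^ x.d)]
          simp only [mul_assoc]
          rw [← mul_assoc (g₂ ^ y.b) (g₄ ^ x.d), ← h₄c]
          simp only [mul_assoc]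
          rw [← mul_assoc (g₄ ^ y.d) (g₄ ^ x.d), ← h₄c, ← mul_assoc (g₂ ^ x.b)]
          simp only [mul_assoc]
          rw [← mul_assoc (g₂ ^ x.b) (g₄ ^ x.d), ← h₄c]
          simp only [mul_assoc]
      _ = _ := by
          have h₄y : g₂ ^ x.b * g₄ ^ y.d = g₄ ^ y.d * g₂ ^ x.b :=
            (((show Commute g₄ (g₂ ^ x.b) from h₄ _).zpow_left _).eq).symm
          rw [h₄y, mul_assoc (κ ^ e * κ ^ e'), ← zpow_add κ e, ← zpow_add κ (x.b * y.a), hκc]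
          simp only [mul_assoc, zpow_add]

/-- Words evaluating to `1` are central. -/
lemma mul_comm_of_eval_eq_one (hκ : ∀ x, κ * x = x * κ) (hκ2 : κ ^ 2 = 1)
    (h₂₁ : g₂ * g₁ = g₁ * g₂ * κ) (h₂₃ : g₂ * g₃ = g₃ * g₂ * κ) (h₁₃ : g₁ * g₃ = g₃ * g₁)
    (h₄ : ∀ x, g₄ * x = x * g₄) (hκ1 : κ ≠ 1) {x : Word}
    (hx : eval hκ hκ2 h₂₁ h₂₃ h₁₃ h₄ x = 1) (y : Word) : x * y = y * x := by
  have h : eval hκ hκ2 h₂₁ h₂₃ h₁₃ h₄ (x * y) = eval hκ hκ2 h₂₁ h₂₃ h₁₃ h₄ (y * x) := by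
    rw [map_mul, map_mul, hx, one_mul, mul_one]
  simp only [eval, MonoidHom.coe_mk, OneHom.coe_mk] at h
  have ha : (x * y).a = (y * x).a := add_comm _ _
  have hb : (x * y).b = (y * x).b := add_comm _ _
  have hc : (x * y).c = (y * x).c := add_comm _ _
  have hd : (x * y).d = (y * x).d := add_comm _ _
  rw [ha, hb, hc, hd] at h
  exact Word.ext ha hb hc hd
    (modTwoHom_injective hκ2 hκ1 (Additive.toMul.injective (mul_left_cancel h)))

end Eval

/-- The sign part of `Word.cocycle`, for signs `(-1) ^ u` and `(-1) ^ v`. -/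
def signCocycle (u v : ZMod 2) (x y : Word) : ZMod 2 :=
  u * (x.e * (y.a + y.c) + x.b * tri (y.a + y.c)) +
    v * (x.e * y.b + (y.a + y.c) * tri x.b + x.b * (y.a + y.c) * y.b)

lemma signCocycle_eq (u v : ZMod 2) (x y z : Word) :
    signCocycle u v x y + signCocycle u v (x * y) z =
      signCocycle u v x (y * z) + signCocycle u v y z := by
  have h : y.a + z.a + (y.c + z.c) = (y.a + y.c) + (z.a + z.c) := by ring
  simp only [signCocycle, mul_a, mul_b, mul_c, mul_e, h, tri_add]
  push_cast
  ring

/-- A 2-cocycle on words, with prescribed commutator pairing. -/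
def cocycle {V : Type*} [AddCommGroup V] (J : ZMod 2 →+ V) (u v : ZMod 2)
    (p₂₁ p₂₃ p₃₁ p₄₁ p₄₂ p₄₃ : V) (x y : Word) : V :=
  J (signCocycle u v x y) + (x.b * y.a) • p₂₁ + (x.b * y.c) • p₂₃ + (x.c * y.a) • p₃₁ +
    (x.d * y.a) • p₄₁ + (x.d * y.b) • p₄₂ + (x.d * y.c) • p₄₃

section

variable {V : Type*} [AddCommGroup V] (J : ZMod 2 →+ V) (u v : ZMod 2)
  (p₂₁ p₂₃ p₃₁ p₄₁ p₄₂ p₄₃ : V)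

lemma cocycle_eq (x y z : Word) :
    cocycle J u v p₂₁ p₂₃ p₃₁ p₄₁ p₄₂ p₄₃ x y + cocycle J u v p₂₁ p₂₃ p₃₁ p₄₁ p₄₂ p₄₃ (x * y) z =
      cocycle J u v p₂₁ p₂₃ p₃₁ p₄₁ p₄₂ p₄₃ x (y * z) +
        cocycle J u v p₂₁ p₂₃ p₃₁ p₄₁ p₄₂ p₄₃ y z := by
  have h := congrArg J (signCocycle_eq u v x y z)
  simp only [map_add] at h
  simp only [cocycle, mul_a, mul_b, mul_c, mul_d]
  linear_combination (norm := module) h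

lemma cocycle_one_left (x : Word) : cocycle J u v p₂₁ p₂₃ p₃₁ p₄₁ p₄₂ p₄₃ 1 x = 0 := by
  simp [cocycle, signCocycle, tri_zero]

lemma map_mul_intCast (s : ZMod 2) (m : ℤ) : J (s * m) = m • J s := by
  rw [mul_comm, ← zsmul_eq_mul, map_zsmul]

lemma two_zsmul_map (s : ZMod 2) : (2 : ℤ) • J s = 0 := by
  rw [← map_zsmul, two_zsmul, CharTwo.add_self_eq_zero, map_zero]

variable {J u v p₂₁ p₂₃ p₃₁ p₄₁ p₄₂ p₄₃} in
lemma cocycle_comm {w : Word} {b n : ℤ} (hb : w.b = 2 * b) (hn : w.a + w.c = 2 * n)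
    (h₁ : J (u * w.e) + b • J v + w.b • p₂₁ + w.c • p₃₁ + w.d • p₄₁ = 0)
    (h₃ : J (u * w.e) + b • J v + w.b • p₂₃ - w.a • p₃₁ + w.d • p₄₃ = 0)
    (h₄ : w.a • p₄₁ + w.b • p₄₂ + w.c • p₄₃ = 0)
    (h₂ : n • J u + J (v * w.e) - w.a • p₂₁ - w.c • p₂₃ + w.d • p₄₂ = 0) (x : Word) :
    cocycle J u v p₂₁ p₂₃ p₃₁ p₄₁ p₄₂ p₄₃ w x = cocycle J u v p₂₁ p₂₃ p₃₁ p₄₁ p₄₂ p₄₃ x w := by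
  have hb0 : (w.b : ZMod 2) = 0 := by
    rw [hb]; push_cast; exact mul_eq_zero_of_left rfl _
  have hn0 : (w.a + w.c : ZMod 2) = 0 := by
    have := congrArg (Int.cast : ℤ → ZMod 2) hn
    push_cast at this
    rw [this]; exact mul_eq_zero_of_left rfl _
  have hl : signCocycle u v w x = u * w.e * ((x.a + x.c : ℤ) : ZMod 2) + v * w.e * (x.b : ZMod 2) +
      v * ((b * (x.a + x.c) : ℤ) : ZMod 2) := by
    simp only [signCocycle, hb, tri_two_mul]
    push_cast
    have h2 : (2 : ZMod 2) = 0 := rfl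
    rw [h2]
    ring
  have hr : signCocycle u v x w = u * ((n * x.b : ℤ) : ZMod 2) := by
    simp only [signCocycle, hb0, hn0, hn, tri_two_mul]
    push_cast
    ring
  simp only [cocycle, hl, hr, map_add, map_mul_intCast]
  linear_combination (norm := module) x.a • h₁ + x.c • h₃ - x.d • h₄ + x.b • h₂ -
    (n * x.b) • two_zsmul_map J u

end

end Word

/-- If the relations of a group, that is a subgroup `K` of words, satisfy the identities imposed by
the characters, then some cocycle on words has `K` in its radical. -/
theorem exists_cocycle_comm {V : Type*} [AddCommGroup V] [DivisibleBy V ℤ] (J : ZMod 2 →+ V)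
    (hJ : Function.Injective J) (u v : ZMod 2) (K : Subgroup Word) (x y q r w z t : V)
    (ht : (2 : ℤ) • t + x + y = 0)
    (hb : ∀ m ∈ K, 2 ∣ m.b) (hac : ∀ m ∈ K, 2 ∣ m.a + m.c)
    (h₁ : ∀ m ∈ K, ∀ b, m.b = 2 * b →
      m.a • J 1 + b • x + m.c • q + m.d • r + J (u * m.e) = 0)
    (h₃ : ∀ m ∈ K, ∀ b, m.b = 2 * b →
      -m.a • q + b • y + m.c • J 1 + m.d • w + J (u * m.e) = 0)
    (h₄ : ∀ m ∈ K, -m.a • r - m.b • z + m.c • (J 1 - w) + m.d • J 1 = 0)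
    (h₂ : ∀ m ∈ K, ∀ i a c, m.a = 2 * a + i → m.c = 2 * c + i →
      i • t + a • (J (u + v) - x) + c • (J (u + v) - y) + m.d • z + J (v * m.e) = 0) :
    ∃ p₂₁ p₂₃ p₃₁ p₄₁ p₄₂ p₄₃ : V, ∀ m ∈ K, ∀ l : Word,
      Word.cocycle J u v p₂₁ p₂₃ p₃₁ p₄₁ p₄₂ p₄₃ m l =
        Word.cocycle J u v p₂₁ p₂₃ p₃₁ p₄₁ p₄₂ p₄₃ l m := by
  have hJ2 := Word.two_zsmul_map J
  have even_of_smul : ∀ n : ℤ, n • J 1 = 0 → Even n := fun n hn ↦ by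
    rw [← map_zsmul, ← map_zero J] at hn
    have := hJ hn
    rw [zsmul_one, ZMod.intCast_zmod_eq_zero_iff_dvd] at this
    exact even_iff_two_dvd.2 this
  have smul_of_even : ∀ n : ℤ, Even n → n • J 1 = 0 := fun n ⟨k, hk⟩ ↦ by
    linear_combination (norm := (subst hk; module)) k • hJ2 1
  have even_d : ∀ m ∈ K, Even m.a → Even m.d := fun m hm ha ↦ by
    obtain ⟨b, hmb⟩ := hb m hm
    obtain ⟨a, hma⟩ := even_iff_two_dvd.1 ha
    obtain ⟨c, hmc⟩ : 2 ∣ m.c := by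
      have := hac m hm
      omega
    have e₁ := h₁ m hm b hmb
    have e₃ := h₃ m hm b hmb
    have e₄ := h₄ m hm
    have e₂ := h₂ m hm 0 a c (by simpa using hma) (by simpa using hmc)
    rw [map_add] at e₂
    rw [hma, hmc] at e₁ e₃ e₄
    rw [hmb] at e₄
    have : (m.d * m.d) • J 1 = 0 := by
      linear_combination (norm := module) (2 * a) • e₁ + (2 * c) • e₃ + (2 * b) • e₂ + m.d • e₄ -
        (2 * a * a + 2 * c * c + c * m.d) • hJ2 1 - (a + c) • hJ2 (u * m.e) -
        (b * a + b * c) • hJ2 u - (b * a + b * c) • hJ2 v - b • hJ2 (v * m.e)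
    have := even_of_smul _ this
    rw [Int.even_mul] at this
    tauto
  obtain ⟨S, hS⟩ : ∃ S : V, ∀ m ∈ K, m.d • S = 0 ∧ m.a • S = (m.c + m.d) • J 1 := by
    by_cases h : ∀ m ∈ K, Even m.d
    · refine ⟨J 1, fun m hm ↦ ⟨smul_of_even _ (h m hm), ?_⟩⟩
      have hev : Even (m.a - (m.c + m.d)) := by
        have h₁ := even_iff_two_dvd.1 (h m hm)
        have h₂ := hac m hm
        rw [even_iff_two_dvd]
        omega
      rw [← sub_eq_zero, ← sub_smul, smul_of_even _ hev]
    · push Not at h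
      obtain ⟨m₀, hm₀, hd₀⟩ := h
      refine ⟨0, fun m hm ↦ ⟨smul_zero _, ?_⟩⟩
      rw [smul_zero, smul_of_even]
      have ha₀ : ¬ Even m₀.a := fun h ↦ hd₀ (even_d _ hm₀ h)
      have h₁ := even_d _ (K.mul_mem hm hm₀)
      have h₂ := even_d _ hm
      have h₃ := hac m hm
      simp only [Word.mul_a, Word.mul_d] at h₁
      rw [← even_iff_two_dvd] at h₃
      grind
  let p := DivisibleBy.div (x + J v) (2 : ℤ)
  have hp : (2 : ℤ) • p = x + J v := DivisibleBy.div_cancel _ two_ne_zero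
  refine ⟨p, J u - p - t, q + J 1, r + S, z, w, fun m hm ↦ ?_⟩
  obtain ⟨b, hmb⟩ := hb m hm
  obtain ⟨n, hn⟩ := hac m hm
  obtain ⟨S₁, S₂⟩ := hS m hm
  have e₁ := h₁ m hm b hmb
  have e₃ := h₃ m hm b hmb
  have e₄ := h₄ m hm
  have e₂ := h₂ m hm m.a 0 (n - m.a) (by ring) (by lia)
  rw [map_add] at e₂
  have hc' : m.c = 2 * n - m.a := by omega
  apply Word.cocycle_comm hmb hn
  · rw [hmb]
    linear_combination (norm := skip) e₁ + b • hp + b • hJ2 v + S₁ + (n - m.a) • hJ2 1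
    rw [hc']
    module
  · rw [hmb]
    linear_combination (norm := skip) e₃ + b • hJ2 u - b • hp - b • ht - n • hJ2 1
    rw [hc']
    module
  · linear_combination (norm := module) S₂ - e₄ + (m.c + m.d) • hJ2 1
  · linear_combination (norm := skip) e₂ + (n - m.a) • hp + (n - m.a) • ht - (n - m.a) • hJ2 u
    rw [hc']
    module

/-- The unit group of an algebraically closed field is divisible. -/
noncomputable abbrev divisibleByUnits (k : Type*) [Field k] [IsAlgClosed k] :
    DivisibleBy (Additive kˣ) ℤ :=
  let _ : DivisibleBy (Additive kˣ) ℕ := divisibleByOfSMulRightSurj _ _ fun {n} hn x ↦ by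
    obtain ⟨z, hz⟩ := IsAlgClosed.exists_pow_nat_eq (x.toMul : k) (Nat.pos_of_ne_zero hn)
    have hz0 : z ≠ 0 := by
      rintro rfl
      rw [zero_pow hn] at hz
      exact x.toMul.ne_zero hz.symm
    exact ⟨Additive.ofMul (Units.mk0 z hz0), Additive.toMul.injective (Units.ext hz)⟩
  AddGroup.divisibleByIntOfDivisibleByNat _

lemma exists_modTwoHom_eq {k : Type*} [Field k] (h : 2 • Additive.ofMul (-1 : kˣ) = 0) {s : kˣ}
    (hs : s ^ 2 = 1) : ∃ u, Additive.ofMul s = modTwoHom (Additive.ofMul (-1 : kˣ)) h u := by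
  have : s = 1 ∨ s = -1 := by
    rcases mul_self_eq_one_iff.1 ((sq (s : k)).symm.trans (congrArg Units.val hs)) with h | h
    · exact Or.inl (Units.ext h)
    · exact Or.inr (Units.ext h)
  rcases this with rfl | rfl
  · exact ⟨0, by simp⟩
  · exact ⟨1, (modTwoHom_one _ _).symm⟩

lemma zpow_mul_zpow_of_commute {G : Type*} [Group G] {g h : G} (hgh : Commute g h) (i a c : ℤ) :
    g ^ (2 * a + i) * h ^ (2 * c + i) = (g * h) ^ i * (g ^ 2) ^ a * (h ^ 2) ^ c := by
  have h₁ : h ^ i * (g ^ 2) ^ a = (g ^ 2) ^ a * h ^ i :=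
    ((hgh.pow_left 2).zpow_zpow a i).symm.eq
  rw [hgh.mul_zpow, add_comm (2 * a), add_comm (2 * c), zpow_add, zpow_add, zpow_mul, zpow_mul,
    mul_assoc (g ^ i) (h ^ i), h₁]
  simp only [mul_assoc]
  norm_cast

end GammaFour

open GammaFour

/-- Type `γ₄`: there is a 2-cocycle `σ` on `G` trivializing the action of `κ`
on the twisted characters. -/
theorem stmt_9 {k : Type*} [Field k] [IsAlgClosed k] [CharZero k]
    {G : Type*} [Group G] (κ g₁ g₂ g₃ g₄ : G)
    (hκc : ∀ x : G, κ * x = x * κ) (hκ1 : κ ≠ 1) (hκ2 : κ ^ 2 = 1)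
    (hc₁ : ∀ x : G, x * g₁ * x⁻¹ = g₁ ∨ x * g₁ * x⁻¹ = κ * g₁)
    (hc₁' : ∃ x : G, x * g₁ * x⁻¹ = κ * g₁)
    (hc₂ : ∀ x : G, x * g₂ * x⁻¹ = g₂ ∨ x * g₂ * x⁻¹ = κ * g₂)
    (hc₂' : ∃ x : G, x * g₂ * x⁻¹ = κ * g₂)
    (hc₃ : ∀ x : G, x * g₃ * x⁻¹ = g₃ ∨ x * g₃ * x⁻¹ = κ * g₃)
    (hc₃' : ∃ x : G, x * g₃ * x⁻¹ = κ * g₃)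
    (hcomm₁₂ : g₁ * g₂ = κ * (g₂ * g₁))
    (hcomm₂₃ : g₂ * g₃ = κ * (g₃ * g₂))
    (hcomm₁₃ : g₁ * g₃ = g₃ * g₁)
    (hg₄c : ∀ x : G, g₄ * x = x * g₄)
    (hgen : Subgroup.closure {g₁, g₂, g₃, g₄} = ⊤)
    (χ₁ : ↥(Subgroup.centralizer {g₁}) →* kˣ)
    (χ₂ : ↥(Subgroup.centralizer {g₂}) →* kˣ)
    (χ₃ : ↥(Subgroup.centralizer {g₃}) →* kˣ)
    (χ₄ : G →* kˣ)
    (hχ₁ : ∀ hm : g₁ ∈ Subgroup.centralizer {g₁}, χ₁ ⟨g₁, hm⟩ = -1)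
    (hχ₂ : ∀ hm : g₂ ∈ Subgroup.centralizer {g₂}, χ₂ ⟨g₂, hm⟩ = -1)
    (hχ₃ : ∀ hm : g₃ ∈ Subgroup.centralizer {g₃}, χ₃ ⟨g₃, hm⟩ = -1)
    (hχ₄ : χ₄ g₄ = -1)
    (hcompat₁₂ : ∀ (h₁ : κ * g₂ ^ 2 ∈ Subgroup.centralizer {g₁})
        (h₂ : κ * g₁ ^ 2 ∈ Subgroup.centralizer {g₂}),
      χ₁ ⟨κ * g₂ ^ 2, h₁⟩ * χ₂ ⟨κ * g₁ ^ 2, h₂⟩ = 1)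
    (hcompat₂₃ : ∀ (h₁ : κ * g₃ ^ 2 ∈ Subgroup.centralizer {g₂})
        (h₂ : κ * g₂ ^ 2 ∈ Subgroup.centralizer {g₃}),
      χ₂ ⟨κ * g₃ ^ 2, h₁⟩ * χ₃ ⟨κ * g₂ ^ 2, h₂⟩ = 1)
    (hcompat₁₃ : ∀ (h₁ : g₃ ∈ Subgroup.centralizer {g₁})
        (h₂ : g₁ ∈ Subgroup.centralizer {g₃}),
      χ₁ ⟨g₃, h₁⟩ * χ₃ ⟨g₁, h₂⟩ = 1)
    (hκ₁₃ : ∀ (h₁ : κ ∈ Subgroup.centralizer {g₁})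
        (h₂ : κ ∈ Subgroup.centralizer {g₃}),
      χ₁ ⟨κ, h₁⟩ * χ₃ ⟨κ, h₂⟩ = 1)
    (hcompat₁₄ : ∀ h₁ : g₄ ∈ Subgroup.centralizer {g₁},
      χ₁ ⟨g₄, h₁⟩ * χ₄ g₁ = 1)
    (hcompat₂₄ : ∀ h₁ : g₄ ∈ Subgroup.centralizer {g₂},
      χ₂ ⟨g₄, h₁⟩ * χ₄ g₂ = 1)
    (hcompat₃₄ : ∀ h₁ : g₄ ∈ Subgroup.centralizer {g₃},
      χ₃ ⟨g₄, h₁⟩ * χ₄ g₃ = -1) :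
    ∃ σ : G → G → kˣ,
      (∀ a b c : G, σ a b * σ (a * b) c = σ a (b * c) * σ b c) ∧
      (∀ hm : κ ∈ Subgroup.centralizer {g₁},
        σ g₁ κ * (σ κ g₁)⁻¹ * χ₁ ⟨κ, hm⟩ = 1) ∧
      (∀ hm : κ ∈ Subgroup.centralizer {g₂},
        σ g₂ κ * (σ κ g₂)⁻¹ * χ₂ ⟨κ, hm⟩ = 1) ∧
      (∀ hm : κ ∈ Subgroup.centralizer {g₃},
        σ g₃ κ * (σ κ g₃)⁻¹ * χ₃ ⟨κ, hm⟩ = 1) ∧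
      σ g₄ κ * (σ κ g₄)⁻¹ * χ₄ κ = 1 := by
  let _ := divisibleByUnits k
  have h₂₁ : g₂ * g₁ = g₁ * g₂ * κ := by
    rw [hcomm₁₂, ← hκc, ← mul_assoc, ← sq, hκ2, one_mul]
  have h₂₃ : g₂ * g₃ = g₃ * g₂ * κ := by rw [hcomm₂₃, hκc]
  have hsq : ∀ {g h : G}, h * g = g * h * κ → h ^ 2 * g = g * h ^ 2 := fun {g h} hgh ↦ by
    have := zpow_mul_zpow_of_commutator hκc hgh 1 2
    rw [mul_one, zpow_one] at this
    exact_mod_cast (show h ^ (2 : ℤ) * g = g * h ^ (2 : ℤ) by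
      rw [this]; norm_cast; rw [hκ2, mul_one])
  have hsq' : ∀ {g h : G}, h * g = g * h * κ → h * g ^ 2 = g ^ 2 * h := fun {g h} hgh ↦ by
    have := zpow_mul_zpow_of_commutator hκc hgh 2 1
    rw [one_mul, zpow_one] at this
    exact_mod_cast (show h * g ^ (2 : ℤ) = g ^ (2 : ℤ) * h by
      rw [this]; norm_cast; rw [hκ2, mul_one])
  have mem : ∀ {g h : G}, g * h = h * g → h ∈ Subgroup.centralizer {g} := fun h ↦
    Subgroup.mem_centralizer_singleton_iff.2 h.symm
  have two_neg : 2 • Additive.ofMul (-1 : kˣ) = 0 := by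
    rw [← ofMul_pow]; simp
  let J := modTwoHom (Additive.ofMul (-1 : kˣ)) two_neg
  have hJ1 : J 1 = Additive.ofMul (-1 : kˣ) := modTwoHom_one _ _
  have hJ : Function.Injective J := modTwoHom_injective _ fun h ↦ by
    have h' : (-1 : kˣ) = 1 := h
    have := congrArg Units.val h'
    norm_num at this
  have hJ2 := Word.two_zsmul_map J
  have κ₁ : κ ∈ Subgroup.centralizer {g₁} := mem (hκc _).symm
  have κ₂ : κ ∈ Subgroup.centralizer {g₂} := mem (hκc _).symm
  have κ₃ : κ ∈ Subgroup.centralizer {g₃} := mem (hκc _).symm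
  obtain ⟨u, hu⟩ : ∃ u, Additive.ofMul (χ₁ ⟨κ, κ₁⟩) = J u := exists_modTwoHom_eq _ <| by
    rw [← map_pow, show (⟨κ, κ₁⟩ : Subgroup.centralizer {g₁}) ^ 2 = 1 from Subtype.ext hκ2,
      map_one]
  obtain ⟨v, hv⟩ : ∃ v, Additive.ofMul (χ₂ ⟨κ, κ₂⟩) = J v := exists_modTwoHom_eq _ <| by
    rw [← map_pow, show (⟨κ, κ₂⟩ : Subgroup.centralizer {g₂}) ^ 2 = 1 from Subtype.ext hκ2,
      map_one]
  have hu₃ : Additive.ofMul (χ₃ ⟨κ, κ₃⟩) = J u := by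
    have := congrArg Additive.ofMul (hκ₁₃ κ₁ κ₃)
    rw [ofMul_mul, ofMul_one, hu] at this
    linear_combination (norm := module) this - hJ2 u
  have hκ₄ : χ₄ κ = 1 := by
    have := congrArg χ₄ h₂₁
    rw [map_mul, map_mul, map_mul, mul_comm (χ₄ g₁)] at this
    exact (mul_eq_left.1 this.symm)
  have m₁₁ : g₁ ∈ Subgroup.centralizer {g₁} := mem rfl
  have m₁₃ : g₃ ∈ Subgroup.centralizer {g₁} := mem hcomm₁₃
  have m₁₄ : g₄ ∈ Subgroup.centralizer {g₁} := mem (hg₄c _).symm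
  have m₁₂ : g₂ ^ 2 ∈ Subgroup.centralizer {g₁} := mem (hsq h₂₁).symm
  have m₃₁ : g₁ ∈ Subgroup.centralizer {g₃} := mem hcomm₁₃.symm
  have m₃₃ : g₃ ∈ Subgroup.centralizer {g₃} := mem rfl
  have m₃₄ : g₄ ∈ Subgroup.centralizer {g₃} := mem (hg₄c _).symm
  have m₃₂ : g₂ ^ 2 ∈ Subgroup.centralizer {g₃} := mem (hsq h₂₃).symm
  have m₂₁ : g₁ ^ 2 ∈ Subgroup.centralizer {g₂} := mem (hsq' h₂₁)
  have m₂₃ : g₃ ^ 2 ∈ Subgroup.centralizer {g₂} := mem (hsq' h₂₃)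
  have m₂₁₃ : g₁ * g₃ ∈ Subgroup.centralizer {g₂} := mem <| by
    rw [← mul_assoc, h₂₁, mul_assoc, hκc, mul_assoc g₁, ← mul_assoc g₂, h₂₃]
    simp only [mul_assoc]
    rw [← sq, hκ2, mul_one]
  have m₂₂ : g₂ ∈ Subgroup.centralizer {g₂} := mem rfl
  have m₂₄ : g₄ ∈ Subgroup.centralizer {g₂} := mem (hg₄c _).symm
  have f₁₂ : Additive.ofMul (χ₂ ⟨g₁ ^ 2, m₂₁⟩) =
      J (u + v) - Additive.ofMul (χ₁ ⟨g₂ ^ 2, m₁₂⟩) := by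
    have := congrArg Additive.ofMul (hcompat₁₂ (mul_mem κ₁ m₁₂) (mul_mem κ₂ m₂₁))
    rw [← MulMemClass.mk_mul_mk _ _ _ κ₁ m₁₂, ← MulMemClass.mk_mul_mk _ _ _ κ₂ m₂₁,
      map_mul χ₁, map_mul χ₂, ofMul_mul, ofMul_mul, ofMul_mul, ofMul_one, hu, hv] at this
    rw [map_add]
    linear_combination (norm := module) this - hJ2 u - hJ2 v
  have f₃₂ : Additive.ofMul (χ₂ ⟨g₃ ^ 2, m₂₃⟩) =
      J (u + v) - Additive.ofMul (χ₃ ⟨g₂ ^ 2, m₃₂⟩) := by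
    have := congrArg Additive.ofMul (hcompat₂₃ (mul_mem κ₂ m₂₃) (mul_mem κ₃ m₃₂))
    rw [← MulMemClass.mk_mul_mk _ _ _ κ₃ m₃₂, ← MulMemClass.mk_mul_mk _ _ _ κ₂ m₂₃,
      map_mul χ₂, map_mul χ₃, ofMul_mul, ofMul_mul, ofMul_mul, ofMul_one, hu₃, hv] at this
    rw [map_add]
    linear_combination (norm := module) this - hJ2 u - hJ2 v
  have f₁₃ : Additive.ofMul (χ₃ ⟨g₁, m₃₁⟩) = -Additive.ofMul (χ₁ ⟨g₃, m₁₃⟩) :=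
    eq_neg_of_add_eq_zero_right (congrArg Additive.ofMul (hcompat₁₃ m₁₃ m₃₁))
  have f₁₄ : Additive.ofMul (χ₄ g₁) = -Additive.ofMul (χ₁ ⟨g₄, m₁₄⟩) :=
    eq_neg_of_add_eq_zero_right (congrArg Additive.ofMul (hcompat₁₄ m₁₄))
  have f₂₄ : Additive.ofMul (χ₄ g₂) = -Additive.ofMul (χ₂ ⟨g₄, m₂₄⟩) :=
    eq_neg_of_add_eq_zero_right (congrArg Additive.ofMul (hcompat₂₄ m₂₄))
  have f₃₄ : Additive.ofMul (χ₄ g₃) = J 1 - Additive.ofMul (χ₃ ⟨g₄, m₃₄⟩) := by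
    rw [hJ1]
    exact eq_sub_of_add_eq' (congrArg Additive.ofMul (hcompat₃₄ m₃₄))
  have ht : (2 : ℤ) • Additive.ofMul (χ₂ ⟨g₁ * g₃, m₂₁₃⟩) + Additive.ofMul (χ₁ ⟨g₂ ^ 2, m₁₂⟩) +
      Additive.ofMul (χ₃ ⟨g₂ ^ 2, m₃₂⟩) = 0 := by
    have h : (⟨g₁ * g₃, m₂₁₃⟩ : Subgroup.centralizer {g₂}) ^ 2 =
        ⟨g₁ ^ 2, m₂₁⟩ * ⟨g₃ ^ 2, m₂₃⟩ :=
      Subtype.ext ((show Commute g₁ g₃ from hcomm₁₃).mul_pow 2)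
    have := congrArg (fun z ↦ Additive.ofMul (χ₂ z)) h
    simp only [map_mul, map_pow, ofMul_mul, ofMul_pow, f₁₂, f₃₂] at this
    linear_combination (norm := module) this + hJ2 (u + v)
  let π := Word.eval hκc hκ2 h₂₁ h₂₃ hcomm₁₃ hg₄c
  have hπ : ∀ (a b c d e : ℤ), π ⟨a, b, c, d, e⟩ =
      g₁ ^ a * g₃ ^ c * g₄ ^ d * g₂ ^ b * κ ^ e := fun a b c d e ↦
    congrArg (_ * ·) (congrArg Additive.toMul (modTwoHom_intCast (Additive.ofMul κ) hκ2 e))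
  have hπ₁ : π ⟨1, 0, 0, 0, 0⟩ = g₁ := by simpa using hπ 1 0 0 0 0
  have hπ₂ : π ⟨0, 1, 0, 0, 0⟩ = g₂ := by simpa using hπ 0 1 0 0 0
  have hπ₃ : π ⟨0, 0, 1, 0, 0⟩ = g₃ := by simpa using hπ 0 0 1 0 0
  have hπ₄ : π ⟨0, 0, 0, 1, 0⟩ = g₄ := by simpa using hπ 0 0 0 1 0
  have hπκ : π ⟨0, 0, 0, 0, 1⟩ = κ := by simpa using hπ 0 0 0 0 1
  have hsurj : Function.Surjective π := by
    rw [← MonoidHom.range_eq_top, eq_top_iff, ← hgen, Subgroup.closure_le]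
    rintro _ (rfl | rfl | rfl | rfl)
    exacts [⟨_, hπ₁⟩, ⟨_, hπ₂⟩, ⟨_, hπ₃⟩, ⟨_, hπ₄⟩]
  have hcomm : ∀ m, π m = 1 → ∀ l, m * l = l * m := fun m hm l ↦
    Word.mul_comm_of_eval_eq_one _ _ _ _ _ _ hκ1 hm l
  have hb : ∀ m, π m = 1 → 2 ∣ m.b := fun m hm ↦ by
    have := (Word.mul_comm_iff _ _).1 (hcomm m hm ⟨1, 0, 0, 0, 0⟩)
    simpa [ZMod.intCast_zmod_eq_zero_iff_dvd] using this
  have hac : ∀ m, π m = 1 → 2 ∣ m.a + m.c := fun m hm ↦ by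
    have := (Word.mul_comm_iff _ _).1 (hcomm m hm ⟨0, 1, 0, 0, 0⟩)
    rw [← Nat.cast_ofNat, ← ZMod.intCast_zmod_eq_zero_iff_dvd]
    simpa using this.symm
  have hrel : ∀ m, π m = 1 → ∃ e : ℤ, m.e = e ∧
      g₁ ^ m.a * g₃ ^ m.c * g₄ ^ m.d * g₂ ^ m.b * κ ^ e = 1 := fun m hm ↦ by
    obtain ⟨e, he⟩ := ZMod.intCast_surjective m.e
    refine ⟨e, he.symm, ?_⟩
    rw [← hπ, he, ← hm]
  obtain ⟨p₂₁, p₂₃, p₃₁, p₄₁, p₄₂, p₄₃, hrad⟩ := exists_cocycle_comm J hJ u v π.ker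
    (Additive.ofMul (χ₁ ⟨g₂ ^ 2, m₁₂⟩)) (Additive.ofMul (χ₃ ⟨g₂ ^ 2, m₃₂⟩))
    (Additive.ofMul (χ₁ ⟨g₃, m₁₃⟩)) (Additive.ofMul (χ₁ ⟨g₄, m₁₄⟩))
    (Additive.ofMul (χ₃ ⟨g₄, m₃₄⟩)) (Additive.ofMul (χ₂ ⟨g₄, m₂₄⟩))
    (Additive.ofMul (χ₂ ⟨g₁ * g₃, m₂₁₃⟩)) ht hb hac
    (fun m hm b hmb ↦ by
      obtain ⟨e, he, h⟩ := hrel m hm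
      rw [hmb, zpow_mul, zpow_ofNat] at h
      have h' : (⟨g₁, m₁₁⟩ : Subgroup.centralizer {g₁}) ^ m.a * ⟨g₃, m₁₃⟩ ^ m.c *
          ⟨g₄, m₁₄⟩ ^ m.d * ⟨g₂ ^ 2, m₁₂⟩ ^ b * ⟨κ, κ₁⟩ ^ e = 1 := Subtype.ext h
      have := congrArg (fun z ↦ Additive.ofMul (χ₁ z)) h'
      simp only [map_mul, map_zpow, map_one, ofMul_mul, ofMul_zpow, ofMul_one, hχ₁, hu,
        ← hJ1] at this
      rw [he, Word.map_mul_intCast]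
      linear_combination (norm := module) this)
    (fun m hm b hmb ↦ by
      obtain ⟨e, he, h⟩ := hrel m hm
      rw [hmb, zpow_mul, zpow_ofNat] at h
      have h' : (⟨g₁, m₃₁⟩ : Subgroup.centralizer {g₃}) ^ m.a * ⟨g₃, m₃₃⟩ ^ m.c *
          ⟨g₄, m₃₄⟩ ^ m.d * ⟨g₂ ^ 2, m₃₂⟩ ^ b * ⟨κ, κ₃⟩ ^ e = 1 := Subtype.ext h
      have := congrArg (fun z ↦ Additive.ofMul (χ₃ z)) h'
      simp only [map_mul, map_zpow, map_one, ofMul_mul, ofMul_zpow, ofMul_one, hχ₃, hu₃, f₁₃,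
        ← hJ1] at this
      rw [he, Word.map_mul_intCast]
      linear_combination (norm := module) this)
    (fun m hm ↦ by
      obtain ⟨e, he, h⟩ := hrel m hm
      have := congrArg (fun z ↦ Additive.ofMul (χ₄ z)) h
      simp only [map_mul, map_zpow, map_one, ofMul_mul, ofMul_zpow, ofMul_one, hχ₄, hκ₄, f₁₄,
        f₂₄, f₃₄, ← hJ1] at this
      linear_combination (norm := module) this)
    (fun m hm i a c hma hmc ↦ by
      obtain ⟨e, he, h⟩ := hrel m hm
      obtain ⟨b, hmb⟩ := hb m hm
      have h₁₃ : g₁ ^ m.a * g₃ ^ m.c = (g₁ * g₃) ^ i * (g₁ ^ 2) ^ a * (g₃ ^ 2) ^ c := by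
        rw [hma, hmc]
        exact zpow_mul_zpow_of_commute hcomm₁₃ i a c
      rw [h₁₃] at h
      have h' : (⟨g₁ * g₃, m₂₁₃⟩ : Subgroup.centralizer {g₂}) ^ i * ⟨g₁ ^ 2, m₂₁⟩ ^ a *
          ⟨g₃ ^ 2, m₂₃⟩ ^ c * ⟨g₄, m₂₄⟩ ^ m.d * ⟨g₂, m₂₂⟩ ^ m.b * ⟨κ, κ₂⟩ ^ e = 1 :=
        Subtype.ext h
      have := congrArg (fun z ↦ Additive.ofMul (χ₂ z)) h'
      simp only [map_mul, map_zpow, map_one, ofMul_mul, ofMul_zpow, ofMul_one, hχ₂, hv, f₁₂, f₃₂,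
        ← hJ1] at this
      rw [hmb] at this
      rw [he, Word.map_mul_intCast]
      linear_combination (norm := module) this - b • hJ2 1)
  obtain ⟨σ, hσ, hσ'⟩ := exists_cocycle_of_surjective π hsurj
    (Word.cocycle J u v p₂₁ p₂₃ p₃₁ p₄₁ p₄₂ p₄₃) (Word.cocycle_eq J u v _ _ _ _ _ _)
    (Word.cocycle_one_left J u v _ _ _ _ _ _) fun m hm l ↦ ⟨hcomm m hm l, hrad m hm l⟩
  have hσκ : ∀ m : Word, σ (π m) κ - σ κ (π m) = -((m.a + m.c) • J u + m.b • J v) :=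
    fun m ↦ by
      have h := hσ' m ⟨0, 0, 0, 0, 1⟩ (by rw [Word.mul_comm_iff]; simp)
      rw [hπκ] at h
      rw [h, ← Word.map_mul_intCast, ← Word.map_mul_intCast, ← map_add]
      simp [Word.cocycle, Word.signCocycle, tri_zero]
  have conclude : ∀ (m : Word) (x : kˣ),
      Additive.ofMul x = (m.a + m.c) • J u + m.b • J v →
      (σ (π m) κ).toMul * ((σ κ (π m)).toMul)⁻¹ * x = 1 := fun m x hx ↦ by
    apply Additive.ofMul.injective
    rw [ofMul_mul, ofMul_mul, ofMul_inv, ofMul_toMul, ofMul_toMul, ← sub_eq_add_neg, hσκ m, hx,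
      neg_add_cancel, ofMul_one]
  refine ⟨fun g h ↦ (σ g h).toMul, fun a b c ↦ congrArg Additive.toMul (hσ a b c), fun _ ↦ ?_,
    fun _ ↦ ?_, fun _ ↦ ?_, ?_⟩
  · simpa only [hπ₁] using conclude ⟨1, 0, 0, 0, 0⟩ _ (by simpa using hu)
  · simpa only [hπ₂] using conclude ⟨0, 1, 0, 0, 0⟩ _ (by simpa using hv)
  · simpa only [hπ₃] using conclude ⟨0, 0, 1, 0, 0⟩ _ (by simpa using hu₃)
  · simpa only [hπ₄] using conclude ⟨0, 0, 0, 1, 0⟩ _ (by simp [hκ₄])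
end

section
/- Let G be a group, κ ∈ G central with κ ≠ 1 and κ² = 1, and g₁, g₂, g₃, g₄ ∈ G, each with conjugacy class {g_i, κ·g_i}, such that g₂·g_i = κ·g_i·g₂ for i ∈ {1, 3, 4}, g_i·g_j = g_j·g_i for all distinct i, j ∈ {1, 3, 4}, and G is generated by g₁, g₂, g₃, g₄. Let χ_i : C_G(g_i) → kˣ be group homomorphisms with χ_i(g_i) = −1 for all i, satisfying χ₂(κ·g_i²)·χ_i(κ·g₂²) = 1 for i ∈ {1, 3, 4}, and χ_i(g_j)·χ_j(g_i) = 1 together with χ_i(κ)·χ_j(κ) = 1 for all distinct i, j ∈ {1, 3, 4} (the conditions defining a Yetter–Drinfeld module of type δ₄, with Cartan matrix of type D₄ having central node 2, whose support generates G). Then there exists a 2-cocycle σ on G with values in kˣ such that σ(g_i, κ)·σ(κ, g_i)⁻¹·χ_i(κ) = 1 for i = 1, 2, 3, 4. -/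
theorem exists_units_retraction {k A : Type*} [Field k] [IsAlgClosed k] [CommGroup A]
    (f : kˣ →* A) (hf : Function.Injective f) :
    ∃ r : A →* kˣ, ∀ x, r (f x) = x := by
  have hroot : ∀ {n : ℕ}, n ≠ 0 → Function.Surjective (fun a : kˣ => a ^ n) := by
    intro n hn a
    obtain ⟨z, hz⟩ := IsAlgClosed.exists_pow_nat_eq (a : k) (Nat.pos_of_ne_zero hn)
    have hz0 : z ≠ 0 := by
      rintro rfl
      rw [zero_pow hn] at hz
      exact a.ne_zero hz.symm
    exact ⟨Units.mk0 z hz0, Units.ext (by simpa using hz)⟩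
  let _ : RootableBy kˣ ℕ := rootableByOfPowLeftSurj kˣ ℕ hroot
  let _ : RootableBy kˣ ℤ := Group.rootableByIntOfRootableByNat kˣ
  let _ : DivisibleBy (Additive kˣ) ℤ :=
    { div := fun a n => Additive.ofMul (RootableBy.root a.toMul n)
      div_zero := fun a => congrArg Additive.ofMul (RootableBy.root_zero a.toMul)
      div_cancel := fun a hn => congrArg Additive.ofMul (RootableBy.root_cancel a.toMul hn) }
  obtain ⟨h, hh⟩ := (Module.Baer.of_divisible (Additive kˣ)).extension_property_addMonoidHom
    (MonoidHom.toAdditive f) hf (AddMonoidHom.id _)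
  exact ⟨MonoidHom.toAdditive.symm h, fun x => DFunLike.congr_fun hh (Additive.ofMul x)⟩

open scoped IsMulCommutative in
/-- A central extension of `G` whose kernel contains `kˣ` yields a cocycle on `G` that records
the scalar commutators of the extension. -/
theorem exists_cocycle_of_central_extension {k G E : Type*} [Field k] [IsAlgClosed k]
    [Group G] [Group E] (π : E →* G) (hπ : Function.Surjective π)
    (hker : ∀ x, π x = 1 → x ∈ Subgroup.center E)
    (c : kˣ →* E) (hc : Function.Injective c) (hcπ : ∀ z, π (c z) = 1) :
    ∃ σ : G → G → kˣ,
      (∀ a b d, σ a b * σ (a * b) d = σ a (b * d) * σ b d) ∧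
      ∀ x y z, x * y = c z * (y * x) → σ (π x) (π y) * (σ (π y) (π x))⁻¹ = z := by
  obtain ⟨r, hr⟩ := exists_units_retraction
    (A := Subgroup.center E) (c.codRestrict (Subgroup.center E) fun z => hker _ (hcπ z))
    (fun a b h => hc (congrArg Subtype.val h))
  obtain ⟨s, hs⟩ := hπ.hasRightInverse
  have hm : ∀ a b, s a * s b * (s (a * b))⁻¹ ∈ Subgroup.center E := fun a b =>
    hker _ (by simp [hs _])
  have hcomm : ∀ x, π x = 1 → ∀ y, y * x = x * y := fun x hx y =>
    Subgroup.mem_center_iff.1 (hker x hx) y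
  refine ⟨fun a b => r ⟨_, hm a b⟩, fun a b d => ?_, fun x y z h => ?_⟩
  · rw [← map_mul, ← map_mul]
    congr 1
    apply Subtype.ext
    have h1 := hcomm (s b * s d * (s (b * d))⁻¹) (by simp [hs _]) (s a)
    have h3 := hcomm (s b * s d * (s (b * d))⁻¹) (by simp [hs _])
      (s a * s (b * d) * (s (a * (b * d)))⁻¹)
    simp only [Subgroup.coe_mul]
    rw [h3, mul_assoc (s a) (s (b * d)), ← mul_assoc _ (s a), ← h1, mul_assoc a b d]
    group
  · rw [mul_inv_eq_iff_eq_mul]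
    have hz : z = r ⟨c z, hker _ (hcπ z)⟩ := (hr z).symm
    rw [hz, ← map_mul]
    beta_reduce
    congr 1
    apply Subtype.ext
    have hxy : π x * π y = π y * π x := by
      have := congrArg π h
      simpa [hcπ] using this
    simp only [Subgroup.coe_mul]
    rw [hxy, ← mul_assoc]
    congr 1
    obtain ⟨m, hm⟩ : ∃ m, m = x⁻¹ * s (π x) := ⟨_, rfl⟩
    obtain ⟨n, hn⟩ : ∃ n, n = y⁻¹ * s (π y) := ⟨_, rfl⟩
    have hm1 := hcomm m (by simp [hm, hs _])
    have hn1 := hcomm n (by simp [hn, hs _])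
    rw [show s (π x) = x * m by simp [hm], show s (π y) = y * n by simp [hn]]
    calc x * m * (y * n) = x * y * (m * n) := by
          rw [mul_assoc, ← mul_assoc m, ← hm1 y]; group
      _ = c z * (y * x * (n * m)) := by rw [h, hm1 n, hn1 m]; group
      _ = c z * (y * n * (x * m)) := by
          rw [mul_assoc y n, ← mul_assoc n, ← hn1 x]; group

/-- The set `D × V` with multiplication twisted by a bimultiplicative map from `V` to the
center of `D`. -/
@[ext]
structure TwistedProd (D V : Type*) where
  fst : D
  snd : V

/-- The group structure on `TwistedProd D V` defined by a bimultiplicative map `β`. -/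
abbrev TwistedProd.group {D V M : Type*} [Group D] [AddCommGroup V] [CommGroup M]
    (c : M →* D) (hc : ∀ z x, c z * x = x * c z) (β : V → V → M)
    (hl : ∀ u v w, β (u + v) w = β u w * β v w)
    (hr : ∀ u v w, β u (v + w) = β u v * β u w) : Group (TwistedProd D V) :=
  have hl0 : ∀ w, β 0 w = 1 := fun w => by simpa using hl 0 0 w
  have hr0 : ∀ w, β w 0 = 1 := fun w => by simpa using hr w 0 0
  { mul := fun x y => ⟨x.1 * y.1 * c (β x.2 y.2), x.2 + y.2⟩
    one := ⟨1, 0⟩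
    inv := fun x => ⟨x.1⁻¹ * c (β x.2 x.2), -x.2⟩
    mul_assoc := by
      rintro ⟨a, u⟩ ⟨b, v⟩ ⟨d, w⟩
      refine TwistedProd.ext ?_ (add_assoc u v w)
      change a * b * c (β u v) * d * c (β (u + v) w) = a * (b * d * c (β v w)) * c (β u (v + w))
      rw [mul_assoc (a * b), hc, hl, hr]
      simp only [mul_assoc, ← map_mul]
      congr 4
      rw [mul_left_comm]
      ac_rfl
    one_mul := by
      rintro ⟨a, u⟩
      refine TwistedProd.ext ?_ (zero_add u)
      change 1 * a * c (β 0 u) = a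
      simp [hl0]
    mul_one := by
      rintro ⟨a, u⟩
      refine TwistedProd.ext ?_ (add_zero u)
      change a * 1 * c (β u 0) = a
      simp [hr0]
    inv_mul_cancel := by
      rintro ⟨a, u⟩
      refine TwistedProd.ext ?_ (neg_add_cancel u)
      change a⁻¹ * c (β u u) * a * c (β (-u) u) = 1
      rw [mul_assoc a⁻¹, hc, ← mul_assoc, inv_mul_cancel, one_mul, ← map_mul, ← hl]
      simp [hl0] }

/-- The bimultiplicative form on `ι → ℤ` with matrix `B`. -/
def bimulForm {ι M : Type*} [Fintype ι] [CommGroup M] (B : ι → ι → M) (v w : ι → ℤ) : M :=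
  ∏ i, ∏ j, B i j ^ (v i * w j)

section bimulForm
variable {ι M : Type*} [Fintype ι] [CommGroup M] (B : ι → ι → M)

theorem bimulForm_add_left (u v w : ι → ℤ) :
    bimulForm B (u + v) w = bimulForm B u w * bimulForm B v w := by
  simp [bimulForm, add_mul, zpow_add, Finset.prod_mul_distrib]

theorem bimulForm_add_right (u v w : ι → ℤ) :
    bimulForm B u (v + w) = bimulForm B u v * bimulForm B u w := by
  simp [bimulForm, mul_add, zpow_add, Finset.prod_mul_distrib]

theorem bimulForm_single [DecidableEq ι] (i j : ι) :
    bimulForm B (Pi.single i 1) (Pi.single j 1) = B i j := by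
  rw [bimulForm, Finset.prod_eq_single i, Finset.prod_eq_single j] <;>
    simp +contextual [Pi.single_apply]

end bimulForm

/-- `x` and `y` commute up to the scalar `z`. -/
def CommutesUpTo {M Q : Type*} [CommGroup M] [Group Q] (c : M →* Q) (z : M) (x y : Q) : Prop :=
  x * y = c z * (y * x)

namespace CommutesUpTo
variable {M Q : Type*} [CommGroup M] [Group Q] {c : M →* Q} {z w : M} {x x' y y' : Q}

theorem refl (x : Q) : CommutesUpTo c 1 x x := by simp [CommutesUpTo]

theorem symm (h : CommutesUpTo c z x y) : CommutesUpTo c z⁻¹ y x := by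
  unfold CommutesUpTo at *
  rw [h, ← mul_assoc, ← map_mul]
  simp

theorem mul_left (hc : ∀ z x, c z * x = x * c z) (h : CommutesUpTo c z x y)
    (h' : CommutesUpTo c w x' y) : CommutesUpTo c (z * w) (x * x') y := by
  unfold CommutesUpTo at *
  rw [mul_assoc, h', ← mul_assoc x, ← hc, mul_assoc (c w), ← mul_assoc x, h, mul_comm z w, map_mul]
  simp only [mul_assoc]

theorem mul_right (hc : ∀ z x, c z * x = x * c z) (h : CommutesUpTo c z x y)
    (h' : CommutesUpTo c w x y') : CommutesUpTo c (z * w) x (y * y') := by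
  simpa [mul_comm] using (mul_left hc h.symm h'.symm).symm

theorem inv_left (hc : ∀ z x, c z * x = x * c z) (h : CommutesUpTo c z x y) :
    CommutesUpTo c z⁻¹ x⁻¹ y := by
  unfold CommutesUpTo at *
  rw [inv_mul_eq_iff_eq_mul, ← mul_assoc, ← hc, mul_assoc, ← mul_assoc x, h, map_inv]
  group

theorem of_eq (h : CommutesUpTo c z x y) (hz : z = w) : CommutesUpTo c w x y := hz ▸ h

end CommutesUpTo

theorem exists_units_commutator_two {k : Type*} [Field k] [IsAlgClosed k] (ε ε' : kˣ)
    (hε : ε = 1 ∨ ε = -1) (hε' : ε' = 1 ∨ ε' = -1) :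
    ∃ X Y K : (Matrix (Fin 2) (Fin 2) k)ˣ, ∃ ν : kˣ,
      Y * X = K * (X * Y) ∧
      CommutesUpTo (Units.map (algebraMap k (Matrix (Fin 2) (Fin 2) k)).toMonoidHom) ε K X ∧
      CommutesUpTo (Units.map (algebraMap k (Matrix (Fin 2) (Fin 2) k)).toMonoidHom) ε' K Y ∧
      K * K = Units.map (algebraMap k (Matrix (Fin 2) (Fin 2) k)).toMonoidHom ν := by
  obtain ⟨i, hi⟩ := IsAlgClosed.exists_pow_nat_eq (-1 : k) (n := 2) two_pos
  rw [sq] at hi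
  let s : (Matrix (Fin 2) (Fin 2) k)ˣ := ⟨!![0, 1; 1, 0], !![0, 1; 1, 0],
    by simp [Matrix.one_fin_two], by simp [Matrix.one_fin_two]⟩
  let t : (Matrix (Fin 2) (Fin 2) k)ˣ := ⟨!![i, 0; 0, 1], !![-i, 0; 0, 1],
    by simp [Matrix.one_fin_two, hi], by simp [Matrix.one_fin_two, hi]⟩
  let K : (Matrix (Fin 2) (Fin 2) k)ˣ := ⟨!![i, 0; 0, -i], !![-i, 0; 0, i],
    by simp [Matrix.one_fin_two, hi], by simp [Matrix.one_fin_two, hi]⟩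
  rcases hε with rfl | rfl <;> rcases hε' with rfl | rfl
  · exact ⟨1, 1, 1, 1, by simp [CommutesUpTo]⟩
  · refine ⟨t, s, K⁻¹, -1, ?_, ?_, ?_, ?_⟩ <;> apply Units.ext <;>
    simp [s, t, K, hi, Matrix.one_fin_two]
  · refine ⟨s, t, K, -1, ?_, ?_, ?_, ?_⟩ <;> apply Units.ext <;>
    simp [s, t, K, hi, Matrix.one_fin_two]
  · refine ⟨s, t * s, K, -1, ?_, ?_, ?_, ?_⟩ <;> apply Units.ext <;>
    simp [s, t, K, hi, Matrix.one_fin_two]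

universe u in
/-- A group with central scalars `kˣ` generated up to scalars by `q₁, q₂` and by `u₃, u₄`, which
are central modulo scalars, with prescribed scalar commutators. -/
theorem exists_group_with_scalar_commutators {k : Type u} [Field k] [IsAlgClosed k]
    (ε ε' μ α₃ β₃ α₄ β₄ γ : kˣ) (hε : ε = 1 ∨ ε = -1) (hε' : ε' = 1 ∨ ε' = -1) :
    ∃ (Q : Type u) (_ : Group Q) (c : kˣ →* Q) (K q₁ q₂ u₃ u₄ : Q),
      Function.Injective c ∧ (∀ z x, c z * x = x * c z) ∧
      q₂ * q₁ = K * (q₁ * q₂) ∧ K * K = c μ ∧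
      CommutesUpTo c ε K q₁ ∧ CommutesUpTo c ε' K q₂ ∧
      CommutesUpTo c 1 K u₃ ∧ CommutesUpTo c 1 K u₄ ∧
      CommutesUpTo c α₃ u₃ q₁ ∧ CommutesUpTo c β₃ u₃ q₂ ∧
      CommutesUpTo c α₄ u₄ q₁ ∧ CommutesUpTo c β₄ u₄ q₂ ∧ CommutesUpTo c γ u₃ u₄ := by
  obtain ⟨X, Y, K, ν, hXY, hKX, hKY, hKK⟩ := exists_units_commutator_two ε ε' hε hε'
  obtain ⟨l, hl⟩ := IsAlgClosed.exists_pow_nat_eq ((μ * ν⁻¹ : kˣ) : k) (n := 2) two_pos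
  have hl0 : l ≠ 0 := by
    rintro rfl
    rw [zero_pow two_ne_zero] at hl
    exact (μ * ν⁻¹).ne_zero hl.symm
  obtain ⟨m, hm⟩ : ∃ m : kˣ, m * m = μ * ν⁻¹ :=
    ⟨Units.mk0 l hl0, Units.ext (by simpa [sq] using hl)⟩
  have hcc : ∀ (z : kˣ) (x : (Matrix (Fin 2) (Fin 2) k)ˣ),
      Units.map (algebraMap k (Matrix (Fin 2) (Fin 2) k)).toMonoidHom z * x =
      x * Units.map (algebraMap k (Matrix (Fin 2) (Fin 2) k)).toMonoidHom z := fun z x =>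
    Units.ext (Algebra.commutes (z : k) (x : Matrix (Fin 2) (Fin 2) k))
  have hci : Function.Injective
      (Units.map (algebraMap k (Matrix (Fin 2) (Fin 2) k)).toMonoidHom) :=
    Units.map_injective (algebraMap k (Matrix (Fin 2) (Fin 2) k)).injective
  generalize Units.map (algebraMap k (Matrix (Fin 2) (Fin 2) k)).toMonoidHom = d at *
  let B : Fin 4 → Fin 4 → kˣ := ![![1, 1, 1, 1], ![m, 1, 1, 1], ![α₃, β₃, 1, γ], ![α₄, β₄, 1, 1]]
  let β := bimulForm B
  let e : Fin 4 → (Fin 4 → ℤ) := fun i => Pi.single i 1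
  have hβ : ∀ i j, β (e i) (e j) = B i j := bimulForm_single B
  have hβl := bimulForm_add_left B
  have hβr := bimulForm_add_right B
  have hβ0 : ∀ v, β 0 v = 1 := fun v => by simpa using hβl 0 0 v
  have hβ0' : ∀ v, β v 0 = 1 := fun v => by simpa using hβr v 0 0
  let _ : Group (TwistedProd (Matrix (Fin 2) (Fin 2) k)ˣ (Fin 4 → ℤ)) :=
    TwistedProd.group d hcc β hβl hβr
  have hmul : ∀ (a b : (Matrix (Fin 2) (Fin 2) k)ˣ) (v w : Fin 4 → ℤ),
      (⟨a, v⟩ * ⟨b, w⟩ : TwistedProd (Matrix (Fin 2) (Fin 2) k)ˣ (Fin 4 → ℤ)) =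
        ⟨a * b * d (β v w), v + w⟩ := fun _ _ _ _ => rfl
  let c : kˣ →* TwistedProd (Matrix (Fin 2) (Fin 2) k)ˣ (Fin 4 → ℤ) :=
    { toFun := fun z => ⟨d z, 0⟩
      map_one' := TwistedProd.ext (map_one d) rfl
      map_mul' := fun x y => by rw [hmul]; simp [hβ0] }
  have hcapp : ∀ z, c z = ⟨d z, 0⟩ := fun _ => rfl
  have key : ∀ (a b : (Matrix (Fin 2) (Fin 2) k)ˣ) (v w : Fin 4 → ℤ) (z : kˣ),
      CommutesUpTo d z a b → CommutesUpTo c (z * β v w * (β w v)⁻¹) ⟨a, v⟩ ⟨b, w⟩ := by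
    intro a b v w z h
    unfold CommutesUpTo at *
    rw [hcapp, hmul, hmul, hmul, h, hβ0, zero_add, add_comm v w]
    refine TwistedProd.ext ?_ rfl
    dsimp only
    rw [map_one, mul_one, mul_assoc (d z), ← hcc (β v w), ← hcc (β w v), ← mul_assoc (d z),
      ← map_mul, ← mul_assoc (d (z * β v w * (β w v)⁻¹)), ← map_mul, inv_mul_cancel_right]
  have hKm : ∀ (a : (Matrix (Fin 2) (Fin 2) k)ˣ) (w : Fin 4 → ℤ) (z : kˣ),
      CommutesUpTo d z K a → CommutesUpTo c z ⟨K * d m, 0⟩ ⟨a, w⟩ := fun a w z h => by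
    have h1 : CommutesUpTo d 1 (d m) a := by simpa [CommutesUpTo] using hcc m a
    exact (key _ _ _ _ _ (h.mul_left hcc h1)).of_eq (by simp [hβ0, hβ0'])
  refine ⟨TwistedProd (Matrix (Fin 2) (Fin 2) k)ˣ (Fin 4 → ℤ), _, c, ⟨K * d m, 0⟩, ⟨X, e 0⟩,
    ⟨Y, e 1⟩, ⟨1, e 2⟩, ⟨1, e 3⟩, ?_, ?_, ?_, ?_, ?_, ?_, ?_, ?_, ?_, ?_, ?_, ?_, ?_⟩
  · exact fun a b h => hci (congrArg TwistedProd.fst h)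
  · rintro z ⟨a, v⟩
    rw [hcapp, hmul, hmul, hβ0, hβ0', hcc, zero_add, add_zero]
  · simp only [hmul, hβ, hβ0, zero_add, add_comm (e 1)]
    simp [B, hXY, ← hcc, mul_assoc]
  · rw [hmul, hcapp, hβ0, add_zero, map_one, mul_one, mul_assoc, ← mul_assoc (d m), hcc, mul_assoc,
      ← map_mul, hm, ← mul_assoc, hKK, ← map_mul]
    simp
  · exact hKm _ _ _ hKX
  · exact hKm _ _ _ hKY
  · exact hKm _ _ _ (by simp [CommutesUpTo])
  · exact hKm _ _ _ (by simp [CommutesUpTo])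
  · exact (key 1 X _ _ 1 (by simp [CommutesUpTo])).of_eq (by simp [hβ, B])
  · exact (key 1 Y _ _ 1 (by simp [CommutesUpTo])).of_eq (by simp [hβ, B])
  · exact (key 1 X _ _ 1 (by simp [CommutesUpTo])).of_eq (by simp [hβ, B])
  · exact (key 1 Y _ _ 1 (by simp [CommutesUpTo])).of_eq (by simp [hβ, B])
  · exact (key 1 1 _ _ 1 (by simp [CommutesUpTo])).of_eq (by simp [hβ, B])

theorem exists_partial_character {k G : Type*} [Field k] [Group G] {g : G}
    (χ : ↥(Subgroup.centralizer {g}) →* kˣ) :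
    ∃ f : G → kˣ, (∀ x y, Commute x g → Commute y g → f (x * y) = f x * f y) ∧
      ∀ x h, χ ⟨x, h⟩ = f x := by
  classical
  have hmem : ∀ x, Commute x g → x ∈ Subgroup.centralizer {g} := fun x hx =>
    Subgroup.mem_centralizer_singleton_iff.2 hx.eq
  refine ⟨fun x => if h : x ∈ Subgroup.centralizer {g} then χ ⟨x, h⟩ else 1, fun x y hx hy => ?_,
    fun x h => by simp only [dif_pos h]⟩
  simp only [dif_pos (hmem x hx), dif_pos (hmem y hy), dif_pos (hmem _ (hx.mul_left hy)),
    ← map_mul]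
  rfl

/-- The pairs `(x, y)` such that `x` centralizes `g` and `y` commutes with `q` up to `f x`. -/
def scalarCentralizer {M G Q : Type*} [CommGroup M] [Group G] [Group Q] (c : M →* Q)
    (hc : ∀ z x, c z * x = x * c z) (g : G) (q : Q) (f : G → M)
    (hf : ∀ x y, Commute x g → Commute y g → f (x * y) = f x * f y) : Subgroup (G × Q) where
  carrier := {p | Commute p.1 g ∧ CommutesUpTo c (f p.1) p.2 q}
  one_mem' := by
    have h1 : f 1 = 1 := by simpa using hf 1 1 (Commute.one_left g) (Commute.one_left g)
    exact ⟨Commute.one_left g, by simp [h1, CommutesUpTo]⟩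
  mul_mem' := fun {p r} hp hr => ⟨hp.1.mul_left hr.1,
    (hp.2.mul_left hc hr.2).of_eq (hf _ _ hp.1 hr.1).symm⟩
  inv_mem' := fun {p} hp => ⟨hp.1.inv_left, (hp.2.inv_left hc).of_eq (by
    have h1 : f 1 = 1 := by simpa using hf 1 1 (Commute.one_left g) (Commute.one_left g)
    rw [inv_eq_iff_mul_eq_one, Prod.fst_inv, ← hf _ _ hp.1 hp.1.inv_left, mul_inv_cancel, h1])⟩

/-- If `p₁` and `p₂` have order two and commute modulo a subgroup `Z` which they normalize, then
every product of elements of `Z`, `p₁ * Z` and `{p₂}` lies in one of four cosets of `Z`. -/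
theorem mem_four_cosets_of_mem_closure {W : Type*} [Group W] (Z : Subgroup W) (p₁ p₂ : W)
    (S : Set W) (hZ₁ : ∀ z ∈ Z, p₁⁻¹ * z * p₁ ∈ Z) (hZ₂ : ∀ z ∈ Z, p₂⁻¹ * z * p₂ ∈ Z)
    (h₁ : p₁ * p₁ ∈ Z) (h₂ : p₂ * p₂ ∈ Z) (h₂₁ : (p₁ * p₂)⁻¹ * (p₂ * p₁) ∈ Z)
    (hS : ∀ s ∈ S, s ∈ Z ∨ p₁⁻¹ * s ∈ Z ∨ s = p₂) {x : W} (hx : x ∈ Subgroup.closure S) :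
    x ∈ Z ∨ p₁⁻¹ * x ∈ Z ∨ p₂⁻¹ * x ∈ Z ∨ (p₁ * p₂)⁻¹ * x ∈ Z := by
  let T : W → Prop := fun x => x ∈ Z ∨ p₁⁻¹ * x ∈ Z ∨ p₂⁻¹ * x ∈ Z ∨ (p₁ * p₂)⁻¹ * x ∈ Z
  have hTZ : ∀ x z, T x → z ∈ Z → T (x * z) := by
    intro x z hx hz
    simp only [T, ← mul_assoc, Subgroup.mul_mem_cancel_right _ hz]
    exact hx
  have hT₁ : ∀ x, T x → T (x * p₁) := by
    rintro x (h | h | h | h)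
    · exact Or.inr (Or.inl (by simpa only [mul_assoc] using hZ₁ _ h))
    · exact Or.inl (by simpa [mul_assoc] using mul_mem h₁ (hZ₁ _ h))
    · exact Or.inr (Or.inr (Or.inr (by simpa [mul_assoc] using mul_mem h₂₁ (hZ₁ _ h))))
    · exact Or.inr (Or.inr (Or.inl (by
        simpa [mul_assoc] using mul_mem (hZ₂ _ h₁) (mul_mem h₂₁ (hZ₁ _ h)))))
  have hT₂ : ∀ x, T x → T (x * p₂) := by
    rintro x (h | h | h | h)
    · exact Or.inr (Or.inr (Or.inl (by simpa only [mul_assoc] using hZ₂ _ h)))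
    · exact Or.inr (Or.inr (Or.inr (by simpa [mul_assoc] using hZ₂ _ h)))
    · exact Or.inl (by simpa [mul_assoc] using mul_mem h₂ (hZ₂ _ h))
    · exact Or.inr (Or.inl (by simpa [mul_assoc] using mul_mem h₂ (hZ₂ _ h)))
  have hT₁' : ∀ x, T x → T (x * p₁⁻¹) := fun x hx => by
    simpa [mul_assoc] using hTZ _ _ (hT₁ _ hx) (inv_mem h₁)
  have hT₂' : ∀ x, T x → T (x * p₂⁻¹) := fun x hx => by
    simpa [mul_assoc] using hTZ _ _ (hT₂ _ hx) (inv_mem h₂)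
  change T x
  induction hx using Subgroup.closure_induction_right with
  | one => exact Or.inl (one_mem Z)
  | mul_right x hx y hy ih =>
    rcases hS y hy with h | h | rfl
    · exact hTZ _ _ ih h
    · simpa [mul_assoc] using hTZ _ _ (hT₁ _ ih) h
    · exact hT₂ _ ih
  | mul_inv_cancel x hx y hy ih =>
    rcases hS y hy with h | h | rfl
    · exact hTZ _ _ ih (inv_mem h)
    · simpa [mul_assoc] using hT₁' _ (hTZ _ _ ih (inv_mem h))
    · exact hT₂' _ ih

theorem commute_mul_self_of_eq_central_mul {G : Type*} [Group G] {κ x y : G}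
    (hκc : ∀ x : G, κ * x = x * κ) (hκ2 : κ * κ = 1) (h : y * x = κ * (x * y)) :
    Commute (x * x) y ∧ Commute (y * y) x := by
  have h' : x * y = κ * (y * x) := by
    rw [h, ← mul_assoc, hκ2, one_mul]
  constructor
  · change x * x * y = y * (x * x)
    rw [mul_assoc, h', ← mul_assoc, ← hκc x, mul_assoc κ x, ← mul_assoc x, ← mul_assoc κ, ← h,
      mul_assoc]
  · change y * y * x = x * (y * y)
    rw [mul_assoc, h, ← mul_assoc, ← hκc y, mul_assoc κ y, ← mul_assoc y, ← mul_assoc κ, ← h',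
      mul_assoc]

/-- The cocycle attached to characters `fᵢ` of the centralizers of four generators of type `δ₄`. -/
theorem exists_cocycle_of_partial_characters {k G : Type*} [Field k] [IsAlgClosed k] [Group G]
    (κ g₁ g₂ g₃ g₄ : G) (hκc : ∀ x : G, κ * x = x * κ) (hκ1 : κ ≠ 1) (hκ2 : κ * κ = 1)
    (h₂₁ : g₂ * g₁ = κ * (g₁ * g₂)) (h₂₃ : g₂ * g₃ = κ * (g₃ * g₂))
    (h₂₄ : g₂ * g₄ = κ * (g₄ * g₂))
    (c₁₃ : Commute g₁ g₃) (c₁₄ : Commute g₁ g₄) (c₃₄ : Commute g₃ g₄)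
    (hgen : Subgroup.closure {g₁, g₂, g₃, g₄} = ⊤) (f₁ f₂ f₃ f₄ : G → kˣ)
    (hf₁ : ∀ x y, Commute x g₁ → Commute y g₁ → f₁ (x * y) = f₁ x * f₁ y)
    (hf₂ : ∀ x y, Commute x g₂ → Commute y g₂ → f₂ (x * y) = f₂ x * f₂ y)
    (hf₃ : ∀ x y, Commute x g₃ → Commute y g₃ → f₃ (x * y) = f₃ x * f₃ y)
    (hf₄ : ∀ x y, Commute x g₄ → Commute y g₄ → f₄ (x * y) = f₄ x * f₄ y)
    (v₁ : f₁ g₁ = -1) (v₂ : f₂ g₂ = -1) (v₃ : f₃ g₃ = -1) (v₄ : f₄ g₄ = -1)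
    (k₂₁ : f₂ (κ * g₁ ^ 2) * f₁ (κ * g₂ ^ 2) = 1) (k₂₃ : f₂ (κ * g₃ ^ 2) * f₃ (κ * g₂ ^ 2) = 1)
    (k₂₄ : f₂ (κ * g₄ ^ 2) * f₄ (κ * g₂ ^ 2) = 1)
    (k₁₃ : f₁ g₃ * f₃ g₁ = 1) (k₁₄ : f₁ g₄ * f₄ g₁ = 1) (k₃₄ : f₃ g₄ * f₄ g₃ = 1)
    (hκ₁₃ : f₁ κ * f₃ κ = 1) (hκ₁₄ : f₁ κ * f₄ κ = 1) :
    ∃ σ : G → G → kˣ,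
      (∀ a b c, σ a b * σ (a * b) c = σ a (b * c) * σ b c) ∧
      σ g₁ κ * (σ κ g₁)⁻¹ * f₁ κ = 1 ∧ σ g₂ κ * (σ κ g₂)⁻¹ * f₂ κ = 1 ∧
      σ g₃ κ * (σ κ g₃)⁻¹ * f₃ κ = 1 ∧ σ g₄ κ * (σ κ g₄)⁻¹ * f₄ κ = 1 := by
  have hκ : ∀ x, Commute κ x := hκc
  have hquot : ∀ {x : G}, g₂ * x = κ * (x * g₂) → Commute (g₁⁻¹ * x) g₂ := by
    intro x h
    change g₁⁻¹ * x * g₂ = g₂ * (g₁⁻¹ * x)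
    rw [mul_assoc, inv_mul_eq_iff_eq_mul, ← mul_assoc, ← mul_assoc, ← mul_right_inj κ, ← h]
    have h0 : κ * (g₁ * g₂) = g₂ * g₁ := h₂₁.symm
    simp only [← mul_assoc] at h0 ⊢
    rw [h0]
    simp
  have s₁₁ := Commute.refl g₁
  obtain ⟨s₁₂, s₂₁⟩ := commute_mul_self_of_eq_central_mul hκc hκ2 h₂₁
  obtain ⟨s₃₂, s₂₃⟩ := commute_mul_self_of_eq_central_mul hκc hκ2 h₂₃
  obtain ⟨s₄₂, s₂₄⟩ := commute_mul_self_of_eq_central_mul hκc hκ2 h₂₄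
  have w₃₂ := hquot h₂₃
  have w₄₂ := hquot h₂₄
  obtain ⟨w₃, hw₃⟩ : ∃ w, w = g₁⁻¹ * g₃ := ⟨_, rfl⟩
  obtain ⟨w₄, hw₄⟩ : ∃ w, w = g₁⁻¹ * g₄ := ⟨_, rfl⟩
  rw [← hw₃] at w₃₂
  rw [← hw₄] at w₄₂
  have w₃₁ : Commute w₃ g₁ := hw₃ ▸ s₁₁.inv_left.mul_left c₁₃.symm
  have w₃₃ : Commute w₃ g₃ := hw₃ ▸ c₁₃.inv_left.mul_left (Commute.refl g₃)
  have w₃₄ : Commute w₃ g₄ := hw₃ ▸ c₁₄.inv_left.mul_left c₃₄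
  have w₄₁ : Commute w₄ g₁ := hw₄ ▸ s₁₁.inv_left.mul_left c₁₄.symm
  have w₄₃ : Commute w₄ g₃ := hw₄ ▸ c₁₃.inv_left.mul_left c₃₄.symm
  have w₄₄ : Commute w₄ g₄ := hw₄ ▸ c₁₄.inv_left.mul_left (Commute.refl g₄)
  have t₃ : g₃ = g₁ * w₃ := by simp [hw₃]
  have t₄ : g₄ = g₁ * w₄ := by simp [hw₄]
  have q₃ : g₃ * g₃ = g₁ * g₁ * (w₃ * w₃) := by
    rw [t₃, mul_assoc, ← mul_assoc w₃, w₃₁.eq]; simp only [mul_assoc]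
  have q₄ : g₄ * g₄ = g₁ * g₁ * (w₄ * w₄) := by
    rw [t₄, mul_assoc, ← mul_assoc w₄, w₄₁.eq]; simp only [mul_assoc]
  have a₁₃ : f₁ g₃ = -f₁ w₃ := by rw [t₃, hf₁ _ _ s₁₁ w₃₁, v₁, neg_one_mul]
  have a₁₄ : f₁ g₄ = -f₁ w₄ := by rw [t₄, hf₁ _ _ s₁₁ w₄₁, v₁, neg_one_mul]
  have a₃₃ : f₃ g₁ * f₃ w₃ = -1 := by rw [← hf₃ _ _ c₁₃ w₃₃, ← t₃, v₃]
  have a₃₄ : f₃ g₄ = f₃ g₁ * f₃ w₄ := by rw [← hf₃ _ _ c₁₃ w₄₃, ← t₄]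
  have a₄₃ : f₄ g₃ = f₄ g₁ * f₄ w₃ := by rw [← hf₄ _ _ c₁₄ w₃₄, ← t₃]
  have a₄₄ : f₄ g₁ * f₄ w₄ = -1 := by rw [← hf₄ _ _ c₁₄ w₄₄, ← t₄, v₄]
  rw [sq, sq, hf₂ _ _ (hκ _) s₁₂, hf₁ _ _ (hκ _) s₂₁] at k₂₁
  rw [sq, sq, hf₂ _ _ (hκ _) s₃₂, hf₃ _ _ (hκ _) s₂₃, q₃, hf₂ _ _ s₁₂ (w₃₂.mul_left w₃₂),
    hf₂ _ _ w₃₂ w₃₂] at k₂₃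
  rw [sq, sq, hf₂ _ _ (hκ _) s₄₂, hf₄ _ _ (hκ _) s₂₄, q₄, hf₂ _ _ s₁₂ (w₄₂.mul_left w₄₂),
    hf₂ _ _ w₄₂ w₄₂] at k₂₄
  rw [a₁₃] at k₁₃
  rw [a₁₄] at k₁₄
  have h₃₁ : f₃ g₁ = -(f₁ w₃)⁻¹ := (eq_inv_of_mul_eq_one_right k₁₃).trans inv_neg
  have h₄₁ : f₄ g₁ = -(f₁ w₄)⁻¹ := (eq_inv_of_mul_eq_one_right k₁₄).trans inv_neg
  rw [h₃₁, neg_mul, neg_inj, inv_mul_eq_one] at a₃₃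
  rw [h₄₁, neg_mul, neg_inj, inv_mul_eq_one] at a₄₄
  rw [a₃₄, a₄₃, h₃₁, h₄₁] at k₃₄
  simp only [neg_mul, mul_neg, neg_neg] at k₃₄
  have one_of : ∀ {g : G} {f : G → kˣ},
      (∀ x y, Commute x g → Commute y g → f (x * y) = f x * f y) → f κ * f κ = 1 :=
    fun {g f} hf => by
      have h1 : f 1 = 1 := by simpa using hf 1 1 (Commute.one_left g) (Commute.one_left g)
      rw [← hf _ _ (hκ g) (hκ g), hκ2, h1]
  have pm : ∀ {x : kˣ}, x * x = 1 → x = 1 ∨ x = -1 := fun {x} hx => by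
    rcases mul_self_eq_one_iff.1 (show (x : k) * x = 1 from congrArg Units.val hx) with h | h
    · exact Or.inl (Units.ext h)
    · exact Or.inr (Units.ext h)
  have hε := one_of hf₁
  have hε' := one_of hf₂
  have ε₃ : f₃ κ = f₁ κ := by rw [← mul_right_inj (f₁ κ), hκ₁₃, hε]
  have ε₄ : f₄ κ = f₁ κ := by rw [← mul_right_inj (f₁ κ), hκ₁₄, hε]
  rw [ε₃] at k₂₃
  rw [ε₄] at k₂₄
  obtain ⟨Q, _, c, K, q₁, q₂, u₃, u₄, hci, hcc, hK, hKK, hKq₁, hKq₂, hKu₃, hKu₄, u₃q₁, u₃q₂, u₄q₁,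
    u₄q₂, u₃u₄⟩ := exists_group_with_scalar_commutators (f₁ κ) (f₂ κ) (f₂ κ * f₁ (g₂ * g₂))
      (f₁ w₃) (f₂ w₃) (f₁ w₄) (f₂ w₄) ((f₁ w₃)⁻¹ * f₄ w₃) (pm hε) (pm hε')
  have q₁q₂ : CommutesUpTo c (f₁ κ * (f₂ κ * f₁ (g₂ * g₂)))⁻¹ (q₁ * q₁) q₂ := by
    apply CommutesUpTo.symm
    unfold CommutesUpTo at *
    calc q₂ * (q₁ * q₁) = K * q₁ * (q₂ * q₁) := by rw [← mul_assoc, hK]; simp only [mul_assoc, hK]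
      _ = c (f₁ κ) * (q₁ * (K * K) * (q₁ * q₂)) := by rw [hKq₁, hK]; simp only [mul_assoc]
      _ = _ := by rw [hKK, ← hcc, map_mul c (f₁ κ)]; simp only [mul_assoc]
  have q₂q₁ : CommutesUpTo c (f₁ (g₂ * g₂)) (q₂ * q₂) q₁ := by
    unfold CommutesUpTo at *
    calc q₂ * q₂ * q₁ = q₂ * K * (q₁ * q₂) := by rw [mul_assoc, hK, mul_assoc]
      _ = c (f₂ κ)⁻¹ * (c (f₂ κ) * (q₂ * K)) * (q₁ * q₂) := by simp
      _ = c (f₂ κ)⁻¹ * (K * (q₂ * q₁)) * q₂ := by rw [← hKq₂]; simp only [mul_assoc]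
      _ = c (f₂ κ)⁻¹ * (K * K) * (q₁ * (q₂ * q₂)) := by rw [hK]; simp only [mul_assoc]
      _ = _ := by rw [hKK, ← map_mul]; simp
  let Z : Subgroup (G × Q) :=
    (scalarCentralizer c hcc g₁ q₁ f₁ hf₁ ⊓ scalarCentralizer c hcc g₂ q₂ f₂ hf₂) ⊓
    (scalarCentralizer c hcc g₃ (q₁ * u₃) f₃ hf₃ ⊓ scalarCentralizer c hcc g₄ (q₁ * u₄) f₄ hf₄)
  have hZ : ∀ p : G × Q, p ∈ Z ↔
      ((Commute p.1 g₁ ∧ CommutesUpTo c (f₁ p.1) p.2 q₁) ∧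
        (Commute p.1 g₂ ∧ CommutesUpTo c (f₂ p.1) p.2 q₂)) ∧
      ((Commute p.1 g₃ ∧ CommutesUpTo c (f₃ p.1) p.2 (q₁ * u₃)) ∧
        (Commute p.1 g₄ ∧ CommutesUpTo c (f₄ p.1) p.2 (q₁ * u₄))) := fun p => Iff.rfl
  have zκ : ((κ, K) : G × Q) ∈ Z := by
    refine (hZ _).2 ⟨⟨⟨hκ _, hKq₁⟩, ⟨hκ _, hKq₂⟩⟩, ⟨hκ _, ?_⟩, ⟨hκ _, ?_⟩⟩
    · exact (hKq₁.mul_right hcc hKu₃).of_eq (by simp [ε₃])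
    · exact (hKq₁.mul_right hcc hKu₄).of_eq (by simp [ε₄])
  have z₁ : ((g₁, q₁) * (g₁, q₁) : G × Q) ∈ Z := by
    refine (hZ _).2 ⟨⟨⟨s₁₁.mul_left s₁₁, ?_⟩, ⟨s₁₂, ?_⟩⟩, ⟨c₁₃.mul_left c₁₃, ?_⟩,
      ⟨c₁₄.mul_left c₁₄, ?_⟩⟩ <;> dsimp only [Prod.mk_mul_mk]
    · exact ((CommutesUpTo.refl q₁).mul_left hcc (CommutesUpTo.refl q₁)).of_eq
        (by simp [hf₁ _ _ s₁₁ s₁₁, v₁])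
    · exact q₁q₂.of_eq (by rw [inv_eq_iff_mul_eq_one, ← k₂₁]; ac_rfl)
    · refine (((CommutesUpTo.refl q₁).mul_left hcc (CommutesUpTo.refl q₁)).mul_right hcc
        (u₃q₁.symm.mul_left hcc u₃q₁.symm)).of_eq ?_
      simp [hf₃ _ _ c₁₃ c₁₃, h₃₁]
    · refine (((CommutesUpTo.refl q₁).mul_left hcc (CommutesUpTo.refl q₁)).mul_right hcc
        (u₄q₁.symm.mul_left hcc u₄q₁.symm)).of_eq ?_
      simp [hf₄ _ _ c₁₄ c₁₄, h₄₁]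
  have z₂ : ((g₂, q₂) * (g₂, q₂) : G × Q) ∈ Z := by
    refine (hZ _).2 ⟨⟨⟨s₂₁, q₂q₁⟩, ⟨(Commute.refl g₂).mul_left (Commute.refl g₂), ?_⟩⟩, ⟨s₂₃, ?_⟩,
      ⟨s₂₄, ?_⟩⟩ <;> dsimp only [Prod.mk_mul_mk]
    · exact ((CommutesUpTo.refl q₂).mul_left hcc (CommutesUpTo.refl q₂)).of_eq
        (by simp [hf₂ _ _ (Commute.refl g₂) (Commute.refl g₂), v₂])
    · refine (q₂q₁.mul_right hcc (u₃q₂.symm.mul_left hcc u₃q₂.symm)).of_eq ?_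
      rw [← mul_inv, mul_inv_eq_iff_eq_mul, ← mul_right_inj (f₂ κ * f₂ (g₁ * g₁) * f₁ κ)]
      exact (by ac_rfl : _ = _).trans ((k₂₁.trans k₂₃.symm).trans (by ac_rfl))
    · refine (q₂q₁.mul_right hcc (u₄q₂.symm.mul_left hcc u₄q₂.symm)).of_eq ?_
      rw [← mul_inv, mul_inv_eq_iff_eq_mul, ← mul_right_inj (f₂ κ * f₂ (g₁ * g₁) * f₁ κ)]
      exact (by ac_rfl : _ = _).trans ((k₂₁.trans k₂₄.symm).trans (by ac_rfl))
  have z₃ : ((w₃, u₃) : G × Q) ∈ Z := by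
    refine (hZ _).2 ⟨⟨⟨w₃₁, u₃q₁⟩, ⟨w₃₂, u₃q₂⟩⟩, ⟨w₃₃, ?_⟩, ⟨w₃₄, ?_⟩⟩
    · exact (u₃q₁.mul_right hcc (CommutesUpTo.refl u₃)).of_eq (by rw [mul_one, a₃₃])
    · exact (u₃q₁.mul_right hcc u₃u₄).of_eq (by simp)
  have z₄ : ((w₄, u₄) : G × Q) ∈ Z := by
    refine (hZ _).2 ⟨⟨⟨w₄₁, u₄q₁⟩, ⟨w₄₂, u₄q₂⟩⟩, ⟨w₄₃, ?_⟩, ⟨w₄₄, ?_⟩⟩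
    · refine (u₄q₁.mul_right hcc u₃u₄.symm).of_eq ?_
      rw [mul_inv_eq_iff_eq_mul, ← inv_mul_eq_one, ← k₃₄, mul_left_comm,
        mul_assoc (f₁ w₃)⁻¹, mul_left_comm (f₁ w₃)⁻¹, mul_left_comm (f₁ w₃)⁻¹]
    · exact (u₄q₁.mul_right hcc (CommutesUpTo.refl u₄)).of_eq (by rw [mul_one, a₄₄])
  have zc : ∀ z, ((1, c z) : G × Q) ∈ Z := fun z => by
    have o : ∀ {g : G} {f : G → kˣ} (q : Q),
        (∀ x y, Commute x g → Commute y g → f (x * y) = f x * f y) →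
        Commute 1 g ∧ CommutesUpTo c (f 1) (c z) q := fun {g f} q hf => by
      have h1 : f 1 = 1 := by simpa using hf 1 1 (Commute.one_left g) (Commute.one_left g)
      exact ⟨Commute.one_left g, by simp [CommutesUpTo, h1, hcc]⟩
    exact (hZ _).2 ⟨⟨o _ hf₁, o _ hf₂⟩, o _ hf₃, o _ hf₄⟩
  have hconj : ∀ (x : G) (y : Q) (z : kˣ) (p : G × Q), p ∈ Z → Commute p.1 x →
      CommutesUpTo c z p.2 y → (x, y)⁻¹ * p * (x, y) ∈ Z := by
    intro x y z p hp h h'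
    have : (x, y)⁻¹ * p * (x, y) = (1, c z) * p := by
      rw [mul_assoc, inv_mul_eq_iff_eq_mul]
      refine Prod.ext (by simpa using h.eq) ?_
      unfold CommutesUpTo at h'
      change p.2 * y = y * (c z * p.2)
      rw [h', ← mul_assoc, ← mul_assoc, hcc]
    rw [this]
    exact mul_mem (zc z) hp
  have zcomm : ((g₁, q₁) * (g₂, q₂) : G × Q)⁻¹ * ((g₂, q₂) * (g₁, q₁)) ∈ Z := by
    have h : ((g₁, q₁) * (g₂, q₂) : G × Q)⁻¹ * ((g₂, q₂) * (g₁, q₁)) =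
        (g₂, q₂)⁻¹ * ((g₁, q₁)⁻¹ * (κ, K) * (g₁, q₁)) * (g₂, q₂) := by
      have h' : ((g₂, q₂) * (g₁, q₁) : G × Q) = (κ, K) * ((g₁, q₁) * (g₂, q₂)) :=
        Prod.ext h₂₁ hK
      rw [h']
      group
    have hx := hconj g₁ q₁ _ _ zκ (hκ g₁) hKq₁
    have hx' := ((hZ _).1 hx).1.2
    rw [h]
    exact hconj _ _ _ _ hx hx'.1 hx'.2
  let S : Set (G × Q) :=
    {(g₁, q₁), (g₂, q₂), (g₃, q₁ * u₃), (g₄, q₁ * u₄)} ∪ Set.range fun z => (1, c z)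
  have hS : ∀ s ∈ S, s ∈ Z ∨ (g₁, q₁)⁻¹ * s ∈ Z ∨ s = (g₂, q₂) := by
    rintro s ((rfl | rfl | rfl | rfl) | ⟨z, rfl⟩)
    · exact Or.inr (Or.inl (by rw [inv_mul_cancel]; exact one_mem Z))
    · exact Or.inr (Or.inr rfl)
    · exact Or.inr (Or.inl (by convert z₃ using 1; simp [hw₃]))
    · exact Or.inr (Or.inl (by convert z₄ using 1; simp [hw₄]))
    · exact Or.inl (zc z)
  have hne : ¬ Commute g₁ g₂ := fun h => hκ1 (by
    exact mul_eq_right.1 (h₂₁.symm.trans h.symm.eq))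
  have hker : ∀ p ∈ Subgroup.closure S, p.1 = 1 → p ∈ Z := by
    intro p hp h1
    have cross : ∀ {a : G × Q}, a⁻¹ * p ∈ Z → Commute a.1 g₁ ∧ Commute a.1 g₂ := fun {a} h => by
      have h' := ((hZ _).1 h).1
      simp only [Prod.fst_mul, Prod.fst_inv, h1, mul_one] at h'
      exact ⟨Commute.inv_left_iff.1 h'.1.1, Commute.inv_left_iff.1 h'.2.1⟩
    rcases mem_four_cosets_of_mem_closure Z (g₁, q₁) (g₂, q₂) S
      (fun z hz => hconj _ _ _ z hz ((hZ z).1 hz).1.1.1 ((hZ z).1 hz).1.1.2)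
      (fun z hz => hconj _ _ _ z hz ((hZ z).1 hz).1.2.1 ((hZ z).1 hz).1.2.2)
      z₁ z₂ zcomm hS hp with h | h | h | h
    · exact h
    · exact absurd (cross h).2 hne
    · exact absurd (cross h).1.symm hne
    · refine absurd ?_ hne
      have h' : g₁ * g₂ * g₁ = g₁ * (g₁ * g₂) := (cross h).1.eq
      rw [mul_assoc, mul_right_inj] at h'
      exact h'.symm
  let P := Subgroup.closure S
  let π : P →* G := (MonoidHom.fst G Q).comp P.subtype
  have hm₁ : ((g₁, q₁) : G × Q) ∈ P := Subgroup.subset_closure (by simp [S])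
  have hm₂ : ((g₂, q₂) : G × Q) ∈ P := Subgroup.subset_closure (by simp [S])
  have hm₃ : ((g₃, q₁ * u₃) : G × Q) ∈ P := Subgroup.subset_closure (by simp [S])
  have hm₄ : ((g₄, q₁ * u₄) : G × Q) ∈ P := Subgroup.subset_closure (by simp [S])
  have hmc : ∀ z, ((1, c z) : G × Q) ∈ P := fun z => Subgroup.subset_closure (by simp [S])
  have hmκ : ((κ, K) : G × Q) ∈ P := by
    have h' : ((g₂, q₂) * (g₁, q₁) : G × Q) = (κ, K) * ((g₁, q₁) * (g₂, q₂)) :=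
      Prod.ext h₂₁ hK
    rw [← Subgroup.mul_mem_cancel_right P (mul_mem hm₁ hm₂), ← h']
    exact mul_mem hm₂ hm₁
  have hπ : Function.Surjective π := by
    rw [← MonoidHom.range_eq_top, eq_top_iff, ← hgen, Subgroup.closure_le]
    rintro x (rfl | rfl | rfl | rfl)
    exacts [⟨⟨_, hm₁⟩, rfl⟩, ⟨⟨_, hm₂⟩, rfl⟩, ⟨⟨_, hm₃⟩, rfl⟩, ⟨⟨_, hm₄⟩, rfl⟩]
  have hcent : ∀ x, π x = 1 → x ∈ Subgroup.center P := by
    rintro ⟨p, hp⟩ (h1 : p.1 = 1)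
    have hpZ := (hZ p).1 (hker p hp h1)
    have o : ∀ {g : G} {f : G → kˣ} {q : Q},
        (∀ x y, Commute x g → Commute y g → f (x * y) = f x * f y) →
        CommutesUpTo c (f p.1) p.2 q → Commute p (g, q) := fun {g f q} hf h => by
      have h1' : f 1 = 1 := by simpa using hf 1 1 (Commute.one_left g) (Commute.one_left g)
      refine Prod.ext (by simp [h1]) ?_
      simpa [CommutesUpTo, h1, h1'] using h
    have hle : P ≤ Subgroup.centralizer {p} := by
      rw [Subgroup.closure_le]
      intro s hs
      refine Subgroup.mem_centralizer_singleton_iff.2 ?_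
      rcases hs with ((rfl | rfl | rfl | rfl) | ⟨z, rfl⟩)
      · exact (o hf₁ hpZ.1.1.2).eq.symm
      · exact (o hf₂ hpZ.1.2.2).eq.symm
      · exact (o hf₃ hpZ.2.1.2).eq.symm
      · exact (o hf₄ hpZ.2.2.2).eq.symm
      · exact Prod.ext (by simp) (hcc z p.2)
    rw [Subgroup.mem_center_iff]
    rintro ⟨r, hr⟩
    exact Subtype.ext (Subgroup.mem_centralizer_singleton_iff.1 (hle hr))
  obtain ⟨σ, hσ, hσc⟩ := exists_cocycle_of_central_extension π hπ hcent
    (((MonoidHom.inr G Q).comp c).codRestrict P hmc)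
    (fun a b h => hci (congrArg (fun x : P => x.1.2) h)) (fun z => rfl)
  have hfin : ∀ {g : G} {q : Q} {z : kˣ}, ((g, q) : G × Q) ∈ P → CommutesUpTo c z K q →
      σ g κ * (σ κ g)⁻¹ * z = 1 := fun {g q z} hm h => by
    have h1 : g * κ = 1 * (κ * g) := by rw [one_mul, hκc]
    have : σ g κ * (σ κ g)⁻¹ = z⁻¹ :=
      hσc ⟨_, hm⟩ ⟨_, hmκ⟩ z⁻¹ (Subtype.ext (Prod.ext h1 h.symm))
    rw [this, inv_mul_cancel]
  have hκZ := (hZ _).1 zκ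
  exact ⟨σ, hσ, hfin hm₁ hκZ.1.1.2, hfin hm₂ hκZ.1.2.2, hfin hm₃ hκZ.2.1.2, hfin hm₄ hκZ.2.2.2⟩

/-- Type `δ₄` (Cartan matrix `D₄` with central node `2`): there is a 2-cocycle
`σ` on `G` trivializing the action of `κ` on the twisted characters. -/
theorem stmt_10 {k : Type*} [Field k] [IsAlgClosed k] [CharZero k]
    {G : Type*} [Group G] (κ g₁ g₂ g₃ g₄ : G)
    (hκc : ∀ x : G, κ * x = x * κ) (hκ1 : κ ≠ 1) (hκ2 : κ ^ 2 = 1)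
    (hc₁ : ∀ x : G, x * g₁ * x⁻¹ = g₁ ∨ x * g₁ * x⁻¹ = κ * g₁)
    (hc₁' : ∃ x : G, x * g₁ * x⁻¹ = κ * g₁)
    (hc₂ : ∀ x : G, x * g₂ * x⁻¹ = g₂ ∨ x * g₂ * x⁻¹ = κ * g₂)
    (hc₂' : ∃ x : G, x * g₂ * x⁻¹ = κ * g₂)
    (hc₃ : ∀ x : G, x * g₃ * x⁻¹ = g₃ ∨ x * g₃ * x⁻¹ = κ * g₃)
    (hc₃' : ∃ x : G, x * g₃ * x⁻¹ = κ * g₃)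
    (hc₄ : ∀ x : G, x * g₄ * x⁻¹ = g₄ ∨ x * g₄ * x⁻¹ = κ * g₄)
    (hc₄' : ∃ x : G, x * g₄ * x⁻¹ = κ * g₄)
    (hcomm₂₁ : g₂ * g₁ = κ * (g₁ * g₂))
    (hcomm₂₃ : g₂ * g₃ = κ * (g₃ * g₂))
    (hcomm₂₄ : g₂ * g₄ = κ * (g₄ * g₂))
    (hcomm₁₃ : g₁ * g₃ = g₃ * g₁)
    (hcomm₁₄ : g₁ * g₄ = g₄ * g₁)
    (hcomm₃₄ : g₃ * g₄ = g₄ * g₃)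
    (hgen : Subgroup.closure {g₁, g₂, g₃, g₄} = ⊤)
    (χ₁ : ↥(Subgroup.centralizer {g₁}) →* kˣ)
    (χ₂ : ↥(Subgroup.centralizer {g₂}) →* kˣ)
    (χ₃ : ↥(Subgroup.centralizer {g₃}) →* kˣ)
    (χ₄ : ↥(Subgroup.centralizer {g₄}) →* kˣ)
    (hχ₁ : ∀ hm : g₁ ∈ Subgroup.centralizer {g₁}, χ₁ ⟨g₁, hm⟩ = -1)
    (hχ₂ : ∀ hm : g₂ ∈ Subgroup.centralizer {g₂}, χ₂ ⟨g₂, hm⟩ = -1)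
    (hχ₃ : ∀ hm : g₃ ∈ Subgroup.centralizer {g₃}, χ₃ ⟨g₃, hm⟩ = -1)
    (hχ₄ : ∀ hm : g₄ ∈ Subgroup.centralizer {g₄}, χ₄ ⟨g₄, hm⟩ = -1)
    (hcompat₂₁ : ∀ (h₁ : κ * g₁ ^ 2 ∈ Subgroup.centralizer {g₂})
        (h₂ : κ * g₂ ^ 2 ∈ Subgroup.centralizer {g₁}),
      χ₂ ⟨κ * g₁ ^ 2, h₁⟩ * χ₁ ⟨κ * g₂ ^ 2, h₂⟩ = 1)
    (hcompat₂₃ : ∀ (h₁ : κ * g₃ ^ 2 ∈ Subgroup.centralizer {g₂})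
        (h₂ : κ * g₂ ^ 2 ∈ Subgroup.centralizer {g₃}),
      χ₂ ⟨κ * g₃ ^ 2, h₁⟩ * χ₃ ⟨κ * g₂ ^ 2, h₂⟩ = 1)
    (hcompat₂₄ : ∀ (h₁ : κ * g₄ ^ 2 ∈ Subgroup.centralizer {g₂})
        (h₂ : κ * g₂ ^ 2 ∈ Subgroup.centralizer {g₄}),
      χ₂ ⟨κ * g₄ ^ 2, h₁⟩ * χ₄ ⟨κ * g₂ ^ 2, h₂⟩ = 1)
    (hcompat₁₃ : ∀ (h₁ : g₃ ∈ Subgroup.centralizer {g₁})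
        (h₂ : g₁ ∈ Subgroup.centralizer {g₃}),
      χ₁ ⟨g₃, h₁⟩ * χ₃ ⟨g₁, h₂⟩ = 1)
    (hcompat₁₄ : ∀ (h₁ : g₄ ∈ Subgroup.centralizer {g₁})
        (h₂ : g₁ ∈ Subgroup.centralizer {g₄}),
      χ₁ ⟨g₄, h₁⟩ * χ₄ ⟨g₁, h₂⟩ = 1)
    (hcompat₃₄ : ∀ (h₁ : g₄ ∈ Subgroup.centralizer {g₃})
        (h₂ : g₃ ∈ Subgroup.centralizer {g₄}),
      χ₃ ⟨g₄, h₁⟩ * χ₄ ⟨g₃, h₂⟩ = 1)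
    (hκ₁₃ : ∀ (h₁ : κ ∈ Subgroup.centralizer {g₁})
        (h₂ : κ ∈ Subgroup.centralizer {g₃}),
      χ₁ ⟨κ, h₁⟩ * χ₃ ⟨κ, h₂⟩ = 1)
    (hκ₁₄ : ∀ (h₁ : κ ∈ Subgroup.centralizer {g₁})
        (h₂ : κ ∈ Subgroup.centralizer {g₄}),
      χ₁ ⟨κ, h₁⟩ * χ₄ ⟨κ, h₂⟩ = 1)
    (hκ₃₄ : ∀ (h₁ : κ ∈ Subgroup.centralizer {g₃})
        (h₂ : κ ∈ Subgroup.centralizer {g₄}),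
      χ₃ ⟨κ, h₁⟩ * χ₄ ⟨κ, h₂⟩ = 1) :
    ∃ σ : G → G → kˣ,
      (∀ a b c : G, σ a b * σ (a * b) c = σ a (b * c) * σ b c) ∧
      (∀ hm : κ ∈ Subgroup.centralizer {g₁},
        σ g₁ κ * (σ κ g₁)⁻¹ * χ₁ ⟨κ, hm⟩ = 1) ∧
      (∀ hm : κ ∈ Subgroup.centralizer {g₂},
        σ g₂ κ * (σ κ g₂)⁻¹ * χ₂ ⟨κ, hm⟩ = 1) ∧
      (∀ hm : κ ∈ Subgroup.centralizer {g₃},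
        σ g₃ κ * (σ κ g₃)⁻¹ * χ₃ ⟨κ, hm⟩ = 1) ∧
      (∀ hm : κ ∈ Subgroup.centralizer {g₄},
        σ g₄ κ * (σ κ g₄)⁻¹ * χ₄ ⟨κ, hm⟩ = 1) := by
  obtain ⟨f₁, hf₁, e₁⟩ := exists_partial_character χ₁
  obtain ⟨f₂, hf₂, e₂⟩ := exists_partial_character χ₂
  obtain ⟨f₃, hf₃, e₃⟩ := exists_partial_character χ₃
  obtain ⟨f₄, hf₄, e₄⟩ := exists_partial_character χ₄
  have hκ2' : κ * κ = 1 := by rw [← sq, hκ2]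
  have mem : ∀ {x y : G}, Commute x y → x ∈ Subgroup.centralizer {y} := fun h =>
    Subgroup.mem_centralizer_singleton_iff.2 h.eq
  have hsq : ∀ {x y : G}, y * x = κ * (x * y) →
      κ * x ^ 2 ∈ Subgroup.centralizer {y} ∧ κ * y ^ 2 ∈ Subgroup.centralizer {x} := by
    intro x y h
    obtain ⟨h₁, h₂⟩ := commute_mul_self_of_eq_central_mul hκc hκ2' h
    rw [sq, sq]
    exact ⟨mem (Commute.mul_left (hκc _) h₁), mem (Commute.mul_left (hκc _) h₂)⟩
  have mκ : ∀ x, κ ∈ Subgroup.centralizer {x} := fun x => mem (hκc x)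
  have mg : ∀ x : G, x ∈ Subgroup.centralizer {x} := fun x => mem (Commute.refl x)
  have v₁ := hχ₁ (mg _)
  have v₂ := hχ₂ (mg _)
  have v₃ := hχ₃ (mg _)
  have v₄ := hχ₄ (mg _)
  have k₂₁ := hcompat₂₁ (hsq hcomm₂₁).1 (hsq hcomm₂₁).2
  have k₂₃ := hcompat₂₃ (hsq hcomm₂₃).1 (hsq hcomm₂₃).2
  have k₂₄ := hcompat₂₄ (hsq hcomm₂₄).1 (hsq hcomm₂₄).2
  have k₁₃ := hcompat₁₃ (mem hcomm₁₃.symm) (mem hcomm₁₃)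
  have k₁₄ := hcompat₁₄ (mem hcomm₁₄.symm) (mem hcomm₁₄)
  have k₃₄ := hcompat₃₄ (mem hcomm₃₄.symm) (mem hcomm₃₄)
  have l₁₃ := hκ₁₃ (mκ _) (mκ _)
  have l₁₄ := hκ₁₄ (mκ _) (mκ _)
  simp only [e₁, e₂, e₃, e₄] at v₁ v₂ v₃ v₄ k₂₁ k₂₃ k₂₄ k₁₃ k₁₄ k₃₄ l₁₃ l₁₄ ⊢
  obtain ⟨σ, hσ, r₁, r₂, r₃, r₄⟩ := exists_cocycle_of_partial_characters κ g₁ g₂ g₃ g₄ hκc hκ1 hκ2'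
    hcomm₂₁ hcomm₂₃ hcomm₂₄ hcomm₁₃ hcomm₁₄ hcomm₃₄ hgen f₁ f₂ f₃ f₄ hf₁ hf₂ hf₃ hf₄
    v₁ v₂ v₃ v₄ k₂₁ k₂₃ k₂₄ k₁₃ k₁₄ k₃₄ l₁₃ l₁₄
  exact ⟨σ, hσ, fun _ => r₁, fun _ => r₂, fun _ => r₃, fun _ => r₄⟩
end

section
/- Let H be a group, w a central element of H, and r ≥ 1 an integer. Let G be the quotient of H × ℤ by the central subgroup generated by (w, −r), let ι : H → G be the (injective) homomorphism induced by g ↦ (g, 0), and let τ ∈ G be the image of (1, 1), so that ι(w) = τ^r and τ is central in G. Let σ be a 2-cocycle on H with values in kˣ and define f_σ : H → kˣ by f_σ(g) = σ(g, w)·σ(w, g)⁻¹ (a group homomorphism since w is central). Then the following are equivalent: (i) there exists a 2-cocycle σ̃ on G with values in kˣ whose pullback along ι, namely (g, h) ↦ σ̃(ι(g), ι(h)), is cohomologous to σ; (ii) there exists a group homomorphism f̂ : H → kˣ with f̂(g)^r = f_σ(g) for all g ∈ H and f̂(w) = 1. Moreover, given such f̂, the cocycle σ̃ in (i) can be chosen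 so that additionally σ̃(ι(g), τ)·σ̃(τ, ι(g))⁻¹ = f̂(g) for all g ∈ H. -/
section TwoCocycle

variable {P G A : Type*} [Group P] [Group G] [CommGroup A]

/-- The commutator pairing `σ(x,y) σ(y,x)⁻¹` of a 2-cocycle is multiplicative in the second
variable on the centralizer of the first. -/
theorem cocycle_comm_mul_right {σ : G → G → A}
    (hσ : ∀ a b c : G, σ a b * σ (a * b) c = σ a (b * c) * σ b c)
    {x y z : G} (hy : Commute x y) (hz : Commute x z) :
    σ x (y * z) * (σ (y * z) x)⁻¹ = (σ x y * (σ y x)⁻¹) * (σ x z * (σ z x)⁻¹) := by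
  have h₁ := hσ x y z
  have h₂ := hσ y x z
  have h₃ := hσ y z x
  rw [← hy.eq] at h₂
  rw [← hz.eq] at h₃
  rw [eq_mul_inv_of_mul_eq h₁.symm, eq_inv_mul_of_mul_eq h₂, eq_inv_mul_of_mul_eq h₃]
  apply Additive.ofMul.injective
  simp only [ofMul_mul, ofMul_inv]
  abel

theorem cocycle_comm_mul_left {σ : G → G → A}
    (hσ : ∀ a b c : G, σ a b * σ (a * b) c = σ a (b * c) * σ b c)
    {x y z : G} (hy : Commute x y) (hz : Commute x z) :
    σ (y * z) x * (σ x (y * z))⁻¹ = (σ y x * (σ x y)⁻¹) * (σ z x * (σ x z)⁻¹) := by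
  have h := congrArg (·⁻¹) (cocycle_comm_mul_right hσ hy hz)
  simpa [mul_comm] using h

theorem cocycle_one_left {σ : G → G → A}
    (hσ : ∀ a b c : G, σ a b * σ (a * b) c = σ a (b * c) * σ b c) (x : G) :
    σ 1 x = σ 1 1 := by
  simpa using (hσ 1 1 x).symm

theorem cocycle_one_right {σ : G → G → A}
    (hσ : ∀ a b c : G, σ a b * σ (a * b) c = σ a (b * c) * σ b c) (x : G) :
    σ x 1 = σ 1 1 := by
  simpa using hσ x 1 1

theorem cocycle_comm_pow_right {σ : G → G → A}
    (hσ : ∀ a b c : G, σ a b * σ (a * b) c = σ a (b * c) * σ b c)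
    {x y : G} (h : Commute x y) (n : ℕ) :
    σ x (y ^ n) * (σ (y ^ n) x)⁻¹ = (σ x y * (σ y x)⁻¹) ^ n := by
  induction n with
  | zero => simp [cocycle_one_left hσ x, cocycle_one_right hσ x]
  | succ n ih => rw [pow_succ, pow_succ, cocycle_comm_mul_right hσ (h.pow_right n) h, ih]

/-- If `z` acts freely, as witnessed by the height `n`, then any function is the multiplicative
coboundary of some `θ` along the orbits of `z`. -/
theorem exists_mul_eq_of_height (z : P) (n : P → ℤ) (hn : ∀ p, n (z * p) = n p + 1)
    (c : P → A) : ∃ θ : P → A, ∀ p, θ (z * p) = θ p * c p := by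
  let T : Equiv.Perm (P × A) :=
    { toFun := fun x => (z * x.1, x.2 * c x.1)
      invFun := fun x => (z⁻¹ * x.1, x.2 * (c (z⁻¹ * x.1))⁻¹)
      left_inv := fun x => by simp
      right_inv := fun x => by simp }
  have hfst : ∀ (m : ℤ) (x : P × A), ((T ^ m) x).1 = z ^ m * x.1 := by
    intro m
    induction m with
    | zero => simp
    | succ m ih =>
      intro x
      rw [zpow_add_one, Equiv.Perm.mul_apply, ih, zpow_add_one, mul_assoc]
      rfl
    | pred m ih =>
      intro x
      rw [zpow_sub_one, Equiv.Perm.mul_apply, ih, zpow_sub_one, mul_assoc]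
      rfl
  refine ⟨fun p => ((T ^ n p) (z ^ (-n p) * p, 1)).2, fun p => ?_⟩
  have hs : z ^ (-n (z * p)) * (z * p) = z ^ (-n p) * p := by
    rw [hn, ← mul_assoc, ← zpow_add_one]
    congr 2
    ring
  have hp := hfst (n p) (z ^ (-n p) * p, 1)
  simp only [← mul_assoc, ← zpow_add, add_neg_cancel, zpow_zero, one_mul] at hp
  simp only
  rw [hs, hn, add_comm, zpow_one_add, Equiv.Perm.mul_apply]
  change _ * c _ = _
  rw [hp]

/-- A 2-cocycle descends, up to coboundary, along the quotient by a central element `z` with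
respect to which it is symmetric, provided `z` acts freely. -/
theorem exists_cocycle_descent (π : P →* G) (hπ : Function.Surjective π) (z : P)
    (hz : ∀ p, z * p = p * z) (hker : π.ker = Subgroup.zpowers z)
    (n : P → ℤ) (hn : ∀ p, n (z * p) = n p + 1) (S : P → P → A)
    (hS : ∀ a b c : P, S a b * S (a * b) c = S a (b * c) * S b c)
    (hSz : ∀ p, S z p = S p z) :
    ∃ (σ : G → G → A) (θ : P → A),
      (∀ a b c : G, σ a b * σ (a * b) c = σ a (b * c) * σ b c) ∧
      ∀ p q, σ (π p) (π q) = θ p * θ q * (θ (p * q))⁻¹ * S p q := by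
  obtain ⟨θ, hθ⟩ := exists_mul_eq_of_height z n hn (S z)
  let S' : P → P → A := fun p q => θ p * θ q * (θ (p * q))⁻¹ * S p q
  have hS' : ∀ a b c : P, S' a b * S' (a * b) c = S' a (b * c) * S' b c := by
    intro a b c
    have h := eq_mul_inv_of_mul_eq (hS a b c)
    simp only [S', h, mul_assoc a b c]
    apply Additive.ofMul.injective
    simp only [ofMul_mul, ofMul_inv]
    abel
  have hleft : ∀ p q, S' (z * p) q = S' p q := by
    intro p q
    have h := eq_inv_mul_of_mul_eq (hS z p q)
    simp only [S', h, mul_assoc z p q, hθ]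
    apply Additive.ofMul.injective
    simp only [ofMul_mul, ofMul_inv]
    abel
  have hright : ∀ p q, S' p (z * q) = S' p q := by
    intro p q
    have h₁ := eq_inv_mul_of_mul_eq (hS z p q)
    have h₂ := eq_mul_inv_of_mul_eq (hS p z q).symm
    rw [← hz p, h₁, hSz p] at h₂
    have e : p * (z * q) = z * (p * q) := by rw [← mul_assoc, ← hz, mul_assoc]
    simp only [S', h₂, e, hθ]
    apply Additive.ofMul.injective
    simp only [ofMul_mul, ofMul_inv]
    abel
  have hzpow : ∀ F : P → A, (∀ p, F (z * p) = F p) → ∀ (m : ℤ) p, F (z ^ m * p) = F p := by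
    intro F hF m
    induction m with
    | zero => simp
    | succ m ih => intro p; rw [zpow_add_one, mul_assoc, ih, hF]
    | pred m ih => intro p; rw [zpow_sub_one, mul_assoc, ih, ← hF, mul_inv_cancel_left]
  have hfib : ∀ F : P → A, (∀ p, F (z * p) = F p) → ∀ p q, π p = π q → F p = F q := by
    intro F hF p q hpq
    have hmem : p * q⁻¹ ∈ π.ker := by simp [MonoidHom.mem_ker, hpq]
    rw [hker] at hmem
    obtain ⟨m, hm⟩ := Subgroup.mem_zpowers_iff.mp hmem
    rw [← hzpow F hF m q, hm, inv_mul_cancel_right]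
  let s := Function.surjInv hπ
  have hs : ∀ g, π (s g) = g := Function.surjInv_eq hπ
  have hσ : ∀ p q, S' (s (π p)) (s (π q)) = S' p q := fun p q =>
    (hfib (fun x => S' x _) (fun x => hleft x _) _ _ (hs _)).trans
      (hfib (S' p) (hright p) _ _ (hs _))
  refine ⟨fun g h => S' (s g) (s h), θ, fun a b c => ?_, hσ⟩
  obtain ⟨a, rfl⟩ := hπ a
  obtain ⟨b, rfl⟩ := hπ b
  obtain ⟨c, rfl⟩ := hπ c
  simp only [← map_mul, hσ, hS']

end TwoCocycle


/-- Lifting criterion for 2-cocycles along the central extension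
`G = (H × ℤ)/⟨(w, −r)⟩`: a 2-cocycle `σ` on `H` lifts (up to coboundary) to `G`
iff the homomorphism `f_σ(g) = σ(g,w)·σ(w,g)⁻¹` admits an `r`-th root `f̂` with
`f̂(w) = 1`; moreover the lift can be chosen with prescribed values on `τ`. -/
theorem stmt_12 {k : Type*} [Field k] [IsAlgClosed k] [CharZero k]
    {H G : Type*} [Group H] [Group G]
    (w : H) (hw : ∀ x : H, w * x = x * w) (r : ℕ) (hr : 1 ≤ r)
    (π : H × Multiplicative ℤ →* G) (hπ : Function.Surjective π)
    (hker : π.ker =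
      Subgroup.zpowers ((w, Multiplicative.ofAdd (-(r : ℤ))) : H × Multiplicative ℤ))
    (σ : H → H → kˣ)
    (hσ : ∀ a b c : H, σ a b * σ (a * b) c = σ a (b * c) * σ b c) :
    ((∃ σt : G → G → kˣ,
        (∀ a b c : G, σt a b * σt (a * b) c = σt a (b * c) * σt b c) ∧
        ∃ η : H → kˣ, ∀ a b : H,
          σt (π (a, 1)) (π (b, 1)) = η a * η b * (η (a * b))⁻¹ * σ a b) ↔
      (∃ f : H →* kˣ, (∀ x : H, f x ^ r = σ x w * (σ w x)⁻¹) ∧ f w = 1)) ∧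
    (∀ f : H →* kˣ, (∀ x : H, f x ^ r = σ x w * (σ w x)⁻¹) → f w = 1 →
      ∃ σt : G → G → kˣ,
        (∀ a b c : G, σt a b * σt (a * b) c = σt a (b * c) * σt b c) ∧
        (∃ η : H → kˣ, ∀ a b : H,
          σt (π (a, 1)) (π (b, 1)) = η a * η b * (η (a * b))⁻¹ * σ a b) ∧
        ∀ x : H,
          σt (π (x, 1)) (π (1, Multiplicative.ofAdd 1)) *
            (σt (π (1, Multiplicative.ofAdd 1)) (π (x, 1)))⁻¹ = f x) := by
  set τ : G := π (1, Multiplicative.ofAdd 1) with hτdef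
  have hτ : ∀ x : H, Commute τ (π (x, 1)) := fun x => by
    rw [hτdef, Commute, SemiconjBy, ← map_mul, ← map_mul]
    simp
  have hτw : π (w, 1) = τ ^ r := by
    rw [hτdef, ← map_pow, MonoidHom.eq_iff, hker]
    refine Subgroup.mem_zpowers_iff.mpr ⟨1, ?_⟩
    ext <;> simp
  have lift : ∀ f : H →* kˣ, (∀ x : H, f x ^ r = σ x w * (σ w x)⁻¹) → f w = 1 →
      ∃ σt : G → G → kˣ,
        (∀ a b c : G, σt a b * σt (a * b) c = σt a (b * c) * σt b c) ∧
        (∃ η : H → kˣ, ∀ a b : H,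
          σt (π (a, 1)) (π (b, 1)) = η a * η b * (η (a * b))⁻¹ * σ a b) ∧
        ∀ x : H, σt (π (x, 1)) τ * (σt τ (π (x, 1)))⁻¹ = f x := by
    intro f hf hfw
    obtain ⟨σt, θ, hσt, hθ⟩ := exists_cocycle_descent π hπ (w, Multiplicative.ofAdd (-(r : ℤ)))
      (fun p => by ext1 <;> simp [hw, mul_comm]) hker (fun p => -(p.2.toAdd / r))
      (fun p => by
        have hr' : (r : ℤ) ≠ 0 := by omega
        have e : (-(r : ℤ) + p.2.toAdd) / r = p.2.toAdd / r - 1 := by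
          rw [neg_add_eq_sub, Int.sub_ediv_of_dvd _ dvd_rfl, Int.ediv_self hr']
        simp only [Prod.snd_mul, toAdd_mul, toAdd_ofAdd, e]
        ring)
      (fun p q => σ p.1 q.1 * f q.1 ^ (-p.2.toAdd))
      (fun a b c => by
        have h := eq_mul_inv_of_mul_eq (hσ a.1 b.1 c.1)
        simp only [Prod.fst_mul, Prod.snd_mul, toAdd_mul, map_mul, h, neg_add, zpow_add, mul_zpow]
        apply Additive.ofMul.injective
        simp only [ofMul_mul, ofMul_inv]
        abel)
      (fun p => by simp [hfw, hf])
    refine ⟨σt, hσt, ⟨fun a => θ (a, 1), fun a b => by simp [hθ]⟩, fun x => ?_⟩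
    rw [hτdef, hθ, hθ]
    simp only [Prod.mk_mul_mk, mul_one, one_mul, toAdd_one, toAdd_ofAdd, neg_zero, zpow_zero,
      map_one, cocycle_one_left hσ x, cocycle_one_right hσ x, zpow_neg, zpow_one]
    apply Additive.ofMul.injective
    simp only [ofMul_mul, ofMul_inv]
    abel
  refine ⟨⟨?_, fun ⟨f, hf, hfw⟩ => ?_⟩, lift⟩
  · rintro ⟨σt, hσt, η, hη⟩
    refine ⟨MonoidHom.mk' (fun x => σt (π (x, 1)) τ * (σt τ (π (x, 1)))⁻¹) fun a b => ?_,
      fun x => ?_, ?_⟩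
    · have e : π (a * b, 1) = π (a, 1) * π (b, 1) := by rw [← map_mul]; simp
      simp only [e, cocycle_comm_mul_left hσt (hτ a) (hτ b)]
    · rw [MonoidHom.mk'_apply, ← cocycle_comm_pow_right hσt (hτ x).symm r, ← hτw, hη, hη, hw x]
      apply Additive.ofMul.injective
      simp only [ofMul_mul, ofMul_inv]
      abel
    · have h := cocycle_comm_pow_right hσt (Commute.refl τ) r
      rw [mul_inv_cancel, one_pow, mul_inv_eq_one] at h
      rw [MonoidHom.mk'_apply, hτw, h, mul_inv_cancel]
  · obtain ⟨σt, hσt, hη, -⟩ := lift f hf hfw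
    exact ⟨σt, hσt, hη⟩
end

section
/- With Λ, Ω, u, v, κ, Λ̄, Ω̄, x, y, α, the Λ̄-action on Ω̂̄, crossed homomorphisms, principal crossed homomorphisms and the set 𝒯 as in the context: the assignment sending a crossed homomorphism φ : Λ̄ → Ω̂̄ to the triple (P_φ, χ_φ, ψ_φ), where P_φ(g, h) = φ(ḡ)(h̄), χ_φ(g) = φ(ḡ)(y) and ψ_φ(h) = φ(x)(h̄) (with ḡ the image of g ∈ Λ in Λ̄ and h̄ the image of h ∈ Ω in Ω̄), takes values in 𝒯 and is surjective onto 𝒯; moreover two crossed homomorphisms φ, φ' have the same associated triple if and only if φ' = φ·φ_a for some character a ∈ Ω̂̄. In particular this assignment induces a bijection between H¹(Λ̄, Ω̂̄) (crossed homomorphisms modulo principal ones) and 𝒯. -/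
/-- The action of the automorphisms of `A` on the homomorphisms `A →* M`,
`(s • f) a = f (s⁻¹ a)`. -/
def autActHom (A M : Type*) [Group A] [CommGroup M] : MulAut A →* MulAut (A →* M) where
  toFun s := (s : A ≃* A).monoidHomCongrLeft
  map_one' := rfl
  map_mul' _ _ := rfl

@[simp]
theorem autActHom_apply {A M : Type*} [Group A] [CommGroup M] (s : MulAut A) (f : A →* M) (a : A) :
    autActHom A M s f a = f (s⁻¹ a) := rfl

/-- A crossed homomorphism, viewed as a homomorphism into a semidirect product. -/
def crossedToSemidirect {S A M : Type*} [Group S] [Group A] [CommGroup M] (φ : S →* MulAut A)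
    (c : S → A →* M) (hc : ∀ s t a, c (s * t) a = c s a * c t ((φ s)⁻¹ a)) :
    S →* (A →* M) ⋊[autActHom A M] MulAut A :=
  MonoidHom.mk' (fun s => ⟨c s, φ s⟩) fun s t => by
    ext1
    · ext a
      simp [hc]
    · simp

theorem hom_ext_of_surjective_prod_int {A B G : Type*} [Group A] [Group B] [Group G]
    {p : A × Multiplicative ℤ →* B} (hp : Function.Surjective p) {f g : B →* G}
    (hA : ∀ a, f (p (a, 1)) = g (p (a, 1)))
    (hx : f (p (1, Multiplicative.ofAdd 1)) = g (p (1, Multiplicative.ofAdd 1))) : f = g := by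
  rw [← MonoidHom.cancel_right hp]
  have hZ : (f.comp p).comp (MonoidHom.inr A (Multiplicative ℤ)) =
      (g.comp p).comp (MonoidHom.inr A (Multiplicative ℤ)) := MonoidHom.ext_mint hx
  ext ⟨a, n⟩
  have h : ((a, n) : A × Multiplicative ℤ) = (a, 1) * (1, n) := by simp
  have hn := DFunLike.congr_fun hZ n
  simp only [MonoidHom.comp_apply, MonoidHom.inr_apply] at hn
  simp only [MonoidHom.comp_apply, h, map_mul, hA, hn]

theorem map_eq_sq_of_ker_eq {A B : Type*} [Group A] [Group B]
    {p : A × Multiplicative ℤ →* B} {u : A}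
    (hker : p.ker = Subgroup.zpowers (u, Multiplicative.ofAdd (-2 : ℤ))) :
    p (u, 1) = p (1, Multiplicative.ofAdd 1) * p (1, Multiplicative.ofAdd 1) := by
  have h : (u, Multiplicative.ofAdd (-2 : ℤ)) ∈ p.ker := hker ▸ Subgroup.mem_zpowers _
  rw [MonoidHom.mem_ker] at h
  have h' : ((u, 1) : A × Multiplicative ℤ) = (u, Multiplicative.ofAdd (-2 : ℤ)) *
      ((1, Multiplicative.ofAdd 1) * (1, Multiplicative.ofAdd 1)) := by
    ext1
    · simp
    · rfl
  rw [h', map_mul, h, one_mul, map_mul]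

theorem exists_hom_of_sq_eq {A B G : Type*} [Group A] [Group B] [Group G]
    {p : A × Multiplicative ℤ →* B} (hp : Function.Surjective p) {u : A}
    (hker : p.ker = Subgroup.zpowers (u, Multiplicative.ofAdd (-2 : ℤ)))
    (f : A →* G) (z : G) (hcomm : ∀ a, Commute (f a) z) (hsq : f u = z * z) :
    ∃ F : B →* G, (∀ a, F (p (a, 1)) = f a) ∧ F (p (1, Multiplicative.ofAdd 1)) = z := by
  let g : A × Multiplicative ℤ →* G := f.noncommCoprod (zpowersHom G z) fun a n => by
    simpa using (hcomm a).zpow_right n.toAdd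
  have hg : p.ker ≤ g.ker := by
    rw [hker, Subgroup.zpowers_le, MonoidHom.mem_ker]
    simp [g, hsq, zpow_neg, zpow_ofNat, pow_two]
  refine ⟨p.liftOfSurjective hp ⟨g, hg⟩, fun a => ?_, ?_⟩
  · rw [MonoidHom.liftOfRightInverse_comp_apply]
    simp [g]
  · rw [MonoidHom.liftOfRightInverse_comp_apply]
    simp [g]

theorem IsAlgClosed.exists_unit_mul_self_eq {k : Type*} [Field k] [IsAlgClosed k] (x : kˣ) :
    ∃ z : kˣ, z * z = x := by
  obtain ⟨z, hz⟩ := IsAlgClosed.exists_pow_nat_eq (x : k) two_pos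
  have hz0 : z ≠ 0 := by
    rintro rfl
    exact x.ne_zero (by simpa using hz.symm)
  exact ⟨Units.mk0 z hz0, by ext; simpa [pow_two] using hz⟩

/-- Over an algebraically closed field, characters of abelian groups can
take any prescribed value of compatible order at a given element. -/
theorem exists_unit_character_apply_eq {k : Type*} [Field k] [IsAlgClosed k]
    {A : Type*} [CommGroup A] (g : A) (z : kˣ) (h : orderOf z ∣ orderOf g) :
    ∃ a : A →* kˣ, a g = z := by
  have hpow : ∀ {n : ℕ}, n ≠ 0 → Function.Surjective (fun a : Additive kˣ => n • a) := by
    intro n hn a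
    obtain ⟨w, hw⟩ := IsAlgClosed.exists_pow_nat_eq ((a.toMul : kˣ) : k) (Nat.pos_of_ne_zero hn)
    have hw0 : w ≠ 0 := by
      rintro rfl
      exact a.toMul.ne_zero (by simpa [hn] using hw.symm)
    refine ⟨Additive.ofMul (Units.mk0 w hw0), ?_⟩
    apply Additive.toMul.injective
    ext
    simpa using hw
  let _ : DivisibleBy (Additive kˣ) ℕ := divisibleByOfSMulRightSurj _ _ hpow
  let _ : DivisibleBy (Additive kˣ) ℤ := AddGroup.divisibleByIntOfDivisibleByNat _
  let γ : Subgroup.zpowers g := ⟨g, Subgroup.mem_zpowers g⟩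
  have hγ : ∀ x, x ∈ Subgroup.zpowers γ := by
    rintro ⟨x, n, rfl⟩
    exact ⟨n, by ext; simp [γ]⟩
  let f : Subgroup.zpowers g →* kˣ :=
    monoidHomOfForallMemZpowers hγ (g' := z) (by rwa [Subgroup.orderOf_mk])
  obtain ⟨a, ha⟩ := (Module.Baer.of_divisible (Additive kˣ)).extension_property_addMonoidHom
    (MonoidHom.toAdditive (Subgroup.zpowers g).subtype) (fun _ _ h => Subtype.ext h)
    (MonoidHom.toAdditive f)
  refine ⟨MonoidHom.toAdditive.symm a, ?_⟩
  have := DFunLike.congr_fun ha (Additive.ofMul γ)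
  have h2 : f γ = z := monoidHomOfForallMemZpowers_apply_gen _ _
  rw [← h2]
  exact congrArg Additive.toMul this


/-- The assignment sending a crossed homomorphism `φc : Λ̄ → Ω̂̄` to the triple
`(P_φc, χ_φc, ψ_φc)` takes values in `𝒯`, is surjective onto `𝒯`, and two
crossed homomorphisms have the same triple iff they differ by a principal
crossed homomorphism; hence it induces a bijection `H¹(Λ̄, Ω̂̄) ≃ 𝒯`. -/
theorem stmt_13 {k : Type*} [Field k] [IsAlgClosed k] [CharZero k]
    {Λ Ω : Type*} [CommGroup Λ] [CommGroup Ω]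
    (u : Λ) (v κ : Ω) (hκ2 : κ ^ 2 = 1) (hκ1 : κ ≠ 1)
    {Λb Ωb : Type*} [CommGroup Λb] [CommGroup Ωb]
    (πΛ : Λ × Multiplicative ℤ →* Λb) (hπΛ : Function.Surjective πΛ)
    (hkerΛ : πΛ.ker =
      Subgroup.zpowers ((u, Multiplicative.ofAdd (-2 : ℤ)) : Λ × Multiplicative ℤ))
    (πΩ : Ω × Multiplicative ℤ →* Ωb) (hπΩ : Function.Surjective πΩ)
    (hkerΩ : πΩ.ker =
      Subgroup.zpowers ((v, Multiplicative.ofAdd (-2 : ℤ)) : Ω × Multiplicative ℤ))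
    (φ : Λb →* MulAut Ωb)
    (hφΛ : ∀ a : Λ, φ (πΛ (a, 1)) = 1)
    (hφΩ : ∀ b : Ω,
      φ (πΛ (1, Multiplicative.ofAdd 1)) (πΩ (b, 1)) = πΩ (b, 1))
    (hφy : φ (πΛ (1, Multiplicative.ofAdd 1)) (πΩ (1, Multiplicative.ofAdd 1)) =
      πΩ (κ, 1) * πΩ (1, Multiplicative.ofAdd 1)) :
    -- (a) the extracted triple of any crossed homomorphism lies in 𝒯
    (∀ φc : Λb → (Ωb →* kˣ),
      (∀ (s t : Λb) (ω : Ωb), φc (s * t) ω = φc s ω * φc t ((φ s)⁻¹ ω)) →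
      ((∀ a a' : Λ, ∀ b : Ω,
          φc (πΛ (a * a', 1)) (πΩ (b, 1)) =
            φc (πΛ (a, 1)) (πΩ (b, 1)) * φc (πΛ (a', 1)) (πΩ (b, 1))) ∧
       (∀ a : Λ, ∀ b b' : Ω,
          φc (πΛ (a, 1)) (πΩ (b * b', 1)) =
            φc (πΛ (a, 1)) (πΩ (b, 1)) * φc (πΛ (a, 1)) (πΩ (b', 1))) ∧
       (∀ a a' : Λ,
          φc (πΛ (a * a', 1)) (πΩ (1, Multiplicative.ofAdd 1)) =
            φc (πΛ (a, 1)) (πΩ (1, Multiplicative.ofAdd 1)) *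
              φc (πΛ (a', 1)) (πΩ (1, Multiplicative.ofAdd 1))) ∧
       (∀ b b' : Ω,
          φc (πΛ (1, Multiplicative.ofAdd 1)) (πΩ (b * b', 1)) =
            φc (πΛ (1, Multiplicative.ofAdd 1)) (πΩ (b, 1)) *
              φc (πΛ (1, Multiplicative.ofAdd 1)) (πΩ (b', 1))) ∧
       (φc (πΛ (1, Multiplicative.ofAdd 1)) (πΩ (v, 1)) *
          φc (πΛ (1, Multiplicative.ofAdd 1)) (πΩ (κ, 1)) =
            φc (πΛ (u, 1)) (πΩ (1, Multiplicative.ofAdd 1))) ∧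
       (∀ a : Λ, φc (πΛ (a, 1)) (πΩ (κ, 1)) = 1) ∧
       (∀ a : Λ,
          (φc (πΛ (a, 1)) (πΩ (1, Multiplicative.ofAdd 1))) ^ 2 =
            φc (πΛ (a, 1)) (πΩ (v, 1))) ∧
       (∀ b : Ω,
          (φc (πΛ (1, Multiplicative.ofAdd 1)) (πΩ (b, 1))) ^ 2 =
            φc (πΛ (u, 1)) (πΩ (b, 1))))) ∧
    -- (b) surjectivity onto 𝒯
    (∀ (P : Λ → Ω → kˣ) (χ : Λ →* kˣ) (ψ : Ω →* kˣ),
      (∀ a a' : Λ, ∀ b : Ω, P (a * a') b = P a b * P a' b) →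
      (∀ a : Λ, ∀ b b' : Ω, P a (b * b') = P a b * P a b') →
      ψ v * ψ κ = χ u →
      (∀ a : Λ, P a κ = 1) →
      (∀ a : Λ, χ a ^ 2 = P a v) →
      (∀ b : Ω, ψ b ^ 2 = P u b) →
      ∃ φc : Λb → (Ωb →* kˣ),
        (∀ (s t : Λb) (ω : Ωb), φc (s * t) ω = φc s ω * φc t ((φ s)⁻¹ ω)) ∧
        (∀ (a : Λ) (b : Ω), φc (πΛ (a, 1)) (πΩ (b, 1)) = P a b) ∧
        (∀ a : Λ, φc (πΛ (a, 1)) (πΩ (1, Multiplicative.ofAdd 1)) = χ a) ∧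
        (∀ b : Ω, φc (πΛ (1, Multiplicative.ofAdd 1)) (πΩ (b, 1)) = ψ b)) ∧
    -- (c) two crossed homomorphisms have the same triple iff they differ by a
    -- principal crossed homomorphism
    (∀ φc φc' : Λb → (Ωb →* kˣ),
      (∀ (s t : Λb) (ω : Ωb), φc (s * t) ω = φc s ω * φc t ((φ s)⁻¹ ω)) →
      (∀ (s t : Λb) (ω : Ωb), φc' (s * t) ω = φc' s ω * φc' t ((φ s)⁻¹ ω)) →
      (((∀ (a : Λ) (b : Ω),
          φc (πΛ (a, 1)) (πΩ (b, 1)) = φc' (πΛ (a, 1)) (πΩ (b, 1))) ∧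
        (∀ a : Λ,
          φc (πΛ (a, 1)) (πΩ (1, Multiplicative.ofAdd 1)) =
            φc' (πΛ (a, 1)) (πΩ (1, Multiplicative.ofAdd 1))) ∧
        (∀ b : Ω,
          φc (πΛ (1, Multiplicative.ofAdd 1)) (πΩ (b, 1)) =
            φc' (πΛ (1, Multiplicative.ofAdd 1)) (πΩ (b, 1)))) ↔
       ∃ a : Ωb →* kˣ, ∀ (s : Λb) (ω : Ωb),
          φc' s ω = φc s ω * a ((φ s)⁻¹ ω) * (a ω)⁻¹)) := by
  set x : Λb := πΛ (1, Multiplicative.ofAdd 1) with hx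
  set y : Ωb := πΩ (1, Multiplicative.ofAdd 1) with hy
  have hxx : πΛ (u, 1) = x * x := map_eq_sq_of_ker_eq hkerΛ
  have hyy : πΩ (v, 1) = y * y := map_eq_sq_of_ker_eq hkerΩ
  have mulΛ : ∀ a a' : Λ, πΛ (a * a', 1) = πΛ (a, 1) * πΛ (a', 1) := fun a a' => by
    rw [← map_mul]; simp
  have mulΩ : ∀ b b' : Ω, πΩ (b * b', 1) = πΩ (b, 1) * πΩ (b', 1) := fun b b' => by
    rw [← map_mul]; simp
  have hκκ : πΩ (κ, 1) * πΩ (κ, 1) = 1 := by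
    rw [← mulΩ, ← pow_two, hκ2]; exact map_one _
  have hinvΩ : ∀ b : Ω, (φ x)⁻¹ (πΩ (b, 1)) = πΩ (b, 1) := fun b => by
    rw [MulAut.inv_apply, MulEquiv.symm_apply_eq, hφΩ]
  have hinvy : (φ x)⁻¹ y = πΩ (κ, 1) * y := by
    rw [MulAut.inv_apply, MulEquiv.symm_apply_eq, map_mul, hφΩ, hφy, ← mul_assoc, hκκ, one_mul]
  -- restriction of the cocycle identity to the generators
  have crossΛ : ∀ c : Λb → (Ωb →* kˣ),
      (∀ (s t : Λb) (ω : Ωb), c (s * t) ω = c s ω * c t ((φ s)⁻¹ ω)) →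
      ∀ (a : Λ) (t : Λb) (ω : Ωb), c (πΛ (a, 1) * t) ω = c (πΛ (a, 1)) ω * c t ω := by
    intro c hc a t ω
    rw [hc, hφΛ]; rfl
  refine ⟨?_, ?_, ?_⟩
  · intro c hc
    refine ⟨fun a a' b => ?_, fun a b b' => ?_, fun a a' => ?_, fun b b' => ?_, ?_, fun a => ?_,
      fun a => ?_, fun b => ?_⟩
    · rw [mulΛ, crossΛ c hc]
    · rw [mulΩ, map_mul]
    · rw [mulΛ, crossΛ c hc]
    · rw [mulΩ, map_mul]
    · rw [hxx, hc, hinvy, hyy, map_mul, map_mul, mul_assoc, mul_comm (c x y) (c x _)]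
    · have h1 := crossΛ c hc a x y
      rw [mul_comm (πΛ (a, 1)) x, hc, hinvy, map_mul, mul_comm (c x y), mul_left_inj] at h1
      simpa using h1
    · rw [hyy, map_mul, pow_two]
    · rw [hxx, hc, hinvΩ, pow_two]
  · intro P χ ψ hP hP' huv hPκ hχ hψ
    have hF : ∀ a : Λ, ∃ F : Ωb →* kˣ, (∀ b, F (πΩ (b, 1)) = P a b) ∧ F y = χ a := fun a =>
      exists_hom_of_sq_eq hπΩ hkerΩ (MonoidHom.mk' (P a) (hP' a)) (χ a)
        (fun _ => Commute.all _ _) (by rw [← pow_two]; exact (hχ a).symm)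
    choose F hFΩ hFy using hF
    obtain ⟨w, hw⟩ := IsAlgClosed.exists_unit_mul_self_eq (ψ v)
    obtain ⟨X, hXΩ, hXy⟩ := exists_hom_of_sq_eq hπΩ hkerΩ ψ w (fun _ => Commute.all _ _) hw.symm
    rw [← hy] at hXy
    have hFmul : ∀ a a', F (a * a') = F a * F a' := fun a a' =>
      hom_ext_of_surjective_prod_int hπΩ (fun b => by simp [hFΩ, hP])
        (by rw [MonoidHom.mul_apply, hFy, hFy, hFy, map_mul])
    let f : Λ →* (Ωb →* kˣ) ⋊[autActHom Ωb kˣ] MulAut Ωb :=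
      SemidirectProduct.inl.comp (MonoidHom.mk' F hFmul)
    have hcomm : ∀ a, Commute (f a) ⟨X, φ x⟩ := fun a => by
      refine SemidirectProduct.ext ?_ (by simp [f])
      refine hom_ext_of_surjective_prod_int hπΩ (fun b => ?_) ?_
      · simp [f, hinvΩ, mul_comm]
      · simp only [f, ← hy]
        simp [hinvy, hFΩ, hPκ, mul_comm]
    have hsq : f u = ⟨X, φ x⟩ * ⟨X, φ x⟩ := by
      refine SemidirectProduct.ext ?_ ?_
      · refine hom_ext_of_surjective_prod_int hπΩ (fun b => ?_) ?_
        · simp [f, hinvΩ, hFΩ, hXΩ, ← hψ, pow_two]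
        · simp only [f, ← hy]
          simp [hinvy, hFy, hXΩ, hXy, ← huv, ← hw]
          rw [mul_assoc, mul_comm w (ψ κ)]
      · simp only [f, SemidirectProduct.mul_right, ← map_mul, ← hxx, hφΛ]
        simp
    obtain ⟨H, hHΛ, hHx⟩ := exists_hom_of_sq_eq hπΛ hkerΛ f ⟨X, φ x⟩ hcomm hsq
    rw [← hx] at hHx
    have hright : SemidirectProduct.rightHom.comp H = φ :=
      hom_ext_of_surjective_prod_int hπΛ (fun a => by simp [hHΛ, hφΛ, f]) (by simp [← hx, hHx])
    refine ⟨fun s => (H s).left, fun s t ω => ?_, fun a b => ?_, fun a => ?_, fun b => ?_⟩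
    · simp [← hright]
    · simp [hHΛ, f, hFΩ]
    · simp [hHΛ, f, hFy]
    · simp only [hHx, hXΩ]
  · intro c c' hc hc'
    constructor
    · rintro ⟨hΛΩ, hΛy, hxΩ⟩
      have hΛ : ∀ a, c (πΛ (a, 1)) = c' (πΛ (a, 1)) := fun a =>
        hom_ext_of_surjective_prod_int hπΩ (hΛΩ a) (hΛy a)
      have hd : (c' x y / c x y) ^ 2 = 1 := by
        have h := hΛy u
        rw [hxx, hc, hc', hinvy, map_mul, map_mul, hxΩ] at h
        rw [div_pow, div_eq_one]
        rw [mul_left_comm, mul_left_comm (c' x y), mul_right_inj] at h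
        rw [pow_two, pow_two, h]
      obtain ⟨a₀, ha₀⟩ := exists_unit_character_apply_eq κ (c' x y / c x y) (by
        rw [orderOf_eq_prime hκ2 hκ1]
        exact orderOf_dvd_of_pow_eq_one hd)
      obtain ⟨w, hw⟩ := IsAlgClosed.exists_unit_mul_self_eq (a₀ v)
      obtain ⟨a, haΩ, hay⟩ :=
        exists_hom_of_sq_eq hπΩ hkerΩ a₀ w (fun _ => Commute.all _ _) hw.symm
      refine ⟨a, ?_⟩
      let c'' : Λb → Ωb →* kˣ := fun s => c s * autActHom Ωb kˣ (φ s) a * a⁻¹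
      have hc'' : ∀ s t ω, c'' (s * t) ω = c'' s ω * c'' t ((φ s)⁻¹ ω) := fun s t ω => by
        simp only [c'', MonoidHom.mul_apply, MonoidHom.inv_apply, autActHom_apply, hc, map_mul,
          MulAut.mul_apply, MulAut.inv_apply]
        ext
        push_cast
        field_simp
      have heq : crossedToSemidirect φ c' hc' = crossedToSemidirect φ c'' hc'' := by
        refine hom_ext_of_surjective_prod_int hπΛ (fun g => ?_) ?_
        · refine SemidirectProduct.ext ?_ rfl
          ext1 ω
          simp [crossedToSemidirect, c'', hφΛ, hΛ]
        · refine SemidirectProduct.ext ?_ rfl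
          refine hom_ext_of_surjective_prod_int hπΩ (fun b => ?_) ?_
          · simp [crossedToSemidirect, c'', ← hx, hinvΩ, hxΩ]
          · simp [crossedToSemidirect, c'', ← hx, ← hy, hinvy, haΩ, ha₀, ← mul_assoc]
      intro s ω
      exact DFunLike.congr_fun (congrArg SemidirectProduct.left (DFunLike.congr_fun heq s)) ω
    · rintro ⟨a, ha⟩
      refine ⟨fun g b => ?_, fun g => ?_, fun b => ?_⟩
      · simp [ha, hφΛ]
      · simp [ha, hφΛ]
      · simp [ha, hinvΩ]
end
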